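/- arXiv:2506.22144 — 5 statements merged into one kernel-verified Lean document; each statement's English description precedes it below -/
import Mathlib

section
/- Let P = (Q, Σ, q_in, T) be a Wait-Only protocol and ρ a finite or infinite execution of P. Suppose there exist processes e1, e2 ∈ [1, nb(ρ)] and an index 0 ≤ j < |ρ| such that (i) ρ_j(e1) = ρ_j(e2) ∈ Q_W, (ii) next(ρ, j, e1) = (q, j1), and (iii) next(ρ, j, e2) = (q, j2) with j1 ≤ j2 < |ρ|. Then there exists an execution ρ' of the form ρ_{≤j} ρ'_{j+1} … ρ'_{j2} ρ_{≥j2+1} such that ρ'_k(e1) = ρ'_k(e2) = ρ_k(e1) for all j+1 ≤ k ≤ j1, and ρ'_k(e1) = ρ_k(e1) and ρ'_k(e2) = q for all j1 < k ≤ j2; in particular next(ρ', j, e1) = next(ρ', j, e2) = (q, j1). -/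
set_option maxHeartbeats 1000000

inductive Act (M : Type) where
  | send : M → Act M
  | recv : M → Act M

structure Protocol (Q M : Type) where
  qin : Q
  T : Set (Q × Act M × Q)

namespace Protocol

variable {Q M : Type}

/-- Messages receivable from state `q`. -/
def R (P : Protocol Q M) (q : Q) : Set M := {a | ∃ q', (q, Act.recv a, q') ∈ P.T}

/-- `q` has an outgoing reception transition. -/
def isWaiting (P : Protocol Q M) (q : Q) : Prop := ∃ a q', (q, Act.recv a, q') ∈ P.T

/-- The set of waiting states. -/
def QW (P : Protocol Q M) : Set Q := {q | P.isWaiting q}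

/-- The set of action states. -/
def QA (P : Protocol Q M) : Set Q := {q | ¬ P.isWaiting q}

/-- Wait-Only protocol: every state has no receptions or no broadcasts; the initial
state is an action state; there is no broadcast self-loop. -/
def WaitOnly (P : Protocol Q M) : Prop :=
  (∀ q : Q, ¬ P.isWaiting q ∨ ¬ ∃ a q', (q, Act.send a, q') ∈ P.T) ∧
  ¬ P.isWaiting P.qin ∧
  ∀ q a, (q, Act.send a, q) ∉ P.T

/-- `qu` is an uncoverable state. -/
def Uncoverable (P : Protocol Q M) (qu : Q) : Prop :=
  (∀ q α q', (q, α, q') ∈ P.T → q ≠ qu ∧ q' ≠ qu) ∧ qu ≠ P.qin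

/-- One broadcast step, performed by process `e` via transition `t`. -/
def Step (P : Protocol Q M) {n : ℕ} (e : Fin n) (t : Q × Act M × Q) (C C' : Fin n → Q) : Prop :=
  ∃ q a q', t = (q, Act.send a, q') ∧ t ∈ P.T ∧ C e = q ∧ C' e = q' ∧
    ∀ e' : Fin n, e' ≠ e →
      ((C e', Act.recv a, C' e') ∈ P.T ∨ (a ∉ P.R (C e') ∧ C' e' = C e'))

def StepAny (P : Protocol Q M) {n : ℕ} (C C' : Fin n → Q) : Prop :=
  ∃ e t, P.Step e t C C'

def Reach (P : Protocol Q M) {n : ℕ} : (Fin n → Q) → (Fin n → Q) → Prop :=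
  Relation.ReflTransGen P.StepAny

def Initial (P : Protocol Q M) {n : ℕ} (C : Fin n → Q) : Prop := ∀ e, C e = P.qin

end Protocol

/-- A finite or infinite execution: `len` is the number of configurations (`⊤` = infinite);
configurations beyond the length are irrelevant. -/
structure Exec {Q M : Type} (P : Protocol Q M) (n : ℕ) where
  npos : 0 < n
  len : ℕ∞
  len_pos : 1 ≤ len
  conf : ℕ → Fin n → Q
  init : P.Initial (conf 0)
  step : ∀ i : ℕ, ((i : ℕ∞) + 1) < len → P.StepAny (conf i) (conf (i + 1))

namespace Exec

variable {Q M : Type} {P : Protocol Q M} {n : ℕ}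

open Classical in
/-- First moment `k ≥ j` (within the execution) at which process `e` is in an action
state; `|ρ|` if there is none. -/
noncomputable def nextIdx (ρ : Exec P n) (j : ℕ) (e : Fin n) : ℕ∞ :=
  if h : ∃ k : ℕ, j ≤ k ∧ (k : ℕ∞) < ρ.len ∧ ¬ P.isWaiting (ρ.conf k e)
  then (Nat.find h : ℕ∞)
  else ρ.len

open Classical in
/-- The next action state of process `e` after `j`; the uncoverable state `qu` if none. -/
noncomputable def nextSt (qu : Q) (ρ : Exec P n) (j : ℕ) (e : Fin n) : Q :=
  if h : ∃ k : ℕ, j ≤ k ∧ (k : ℕ∞) < ρ.len ∧ ¬ P.isWaiting (ρ.conf k e)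
  then ρ.conf (Nat.find h) e
  else qu

noncomputable def next (qu : Q) (ρ : Exec P n) (j : ℕ) (e : Fin n) : Q × ℕ∞ :=
  (nextSt qu ρ j e, nextIdx ρ j e)

/-- Well-formed executions. -/
def WellFormed (qu : Q) (ρ : Exec P n) : Prop :=
  ∀ i : ℕ, (i : ℕ∞) < ρ.len → ∀ e1 e2 : Fin n,
    ρ.conf i e1 = ρ.conf i e2 → P.isWaiting (ρ.conf i e1) →
    nextSt qu ρ i e1 = nextSt qu ρ i e2 →
    ∀ k : ℕ, i ≤ k → (k : ℕ∞) ≤ nextIdx ρ i e1 → ρ.conf k e1 = ρ.conf k e2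

/-- The set of indices at which some process currently waiting will reach action state `qa`. -/
def nextSet (qu : Q) (ρ : Exec P n) (j : ℕ) (qa : Q) : Set ℕ :=
  {i | ∃ e : Fin n, P.isWaiting (ρ.conf j e) ∧ next qu ρ j e = (qa, (i : ℕ∞))}

end Exec


namespace Exec

variable {Q M : Type} {P : Protocol Q M} {n : ℕ}

/-- Characterization of `next` when its index is a position of the execution. -/
theorem next_eq_iff_of_lt (qu : Q) (ρ : Exec P n) (j m : ℕ) (e : Fin n) (q : Q)
    (hm : (m : ℕ∞) < ρ.len) :
    next qu ρ j e = (q, (m : ℕ∞)) ↔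
      j ≤ m ∧ ρ.conf m e = q ∧ ¬ P.isWaiting q ∧
        ∀ k, j ≤ k → k < m → P.isWaiting (ρ.conf k e) := by
  classical
  have lt_len : ∀ k : ℕ, k < m → (k : ℕ∞) < ρ.len := fun k hk =>
    lt_trans (by exact_mod_cast hk) hm
  unfold next nextSt nextIdx
  by_cases h : ∃ k : ℕ, j ≤ k ∧ (k : ℕ∞) < ρ.len ∧ ¬ P.isWaiting (ρ.conf k e)
  · simp only [dif_pos h, Prod.mk.injEq, Nat.cast_inj]
    constructor
    · rintro ⟨hq, hfind⟩
      have hspec := Nat.find_spec h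
      rw [hfind] at hq hspec
      refine ⟨hspec.1, hq, hq ▸ hspec.2.2, fun k hjk hkm => ?_⟩
      by_contra hk
      exact Nat.find_min h (hfind ▸ hkm) ⟨hjk, lt_len k hkm, hk⟩
    · rintro ⟨hjm, hq, hact, hmin⟩
      have hfind : Nat.find h = m :=
        (Nat.find_eq_iff h).2
          ⟨⟨hjm, hm, hq ▸ hact⟩, fun k hk hk' => hk'.2.2 (hmin k hk'.1 hk)⟩
      exact ⟨by rw [hfind, hq], hfind⟩
  · simp only [dif_neg h, Prod.mk.injEq]
    constructor
    · rintro ⟨-, hlen⟩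
      exact absurd hm (by simp [hlen])
    · rintro ⟨hjm, hq, hact, -⟩
      exact absurd ⟨m, hjm, hm, hq ▸ hact⟩ h

end Exec

/-- Replacing the local states of a process `f` before and after a step by those of another
receiving process `e`, or by an idle action state, preserves the step relation. -/
theorem Protocol.StepAny.update {Q M : Type} {P : Protocol Q M} (hWO : P.WaitOnly) {n : ℕ}
    {C C' : Fin n → Q} (h : P.StepAny C C') {f : Fin n} (hf : P.isWaiting (C f)) {x x' : Q}
    (hx : (∃ e, P.isWaiting (C e) ∧ x = C e ∧ x' = C' e) ∨ (¬ P.isWaiting x ∧ x' = x)) :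
    P.StepAny (Function.update C f x) (Function.update C' f x') := by
  obtain ⟨s, _, p, a, p', rfl, ht, hp, hp', hrest⟩ := h
  have not_sender : ∀ e, P.isWaiting (C e) → e ≠ s := by
    rintro e he rfl
    exact (hWO.1 (C e)).elim (fun h => h he) (fun h => h ⟨a, p', hp ▸ ht⟩)
  have hsf := (not_sender f hf).symm
  refine ⟨s, _, p, a, p', rfl, ht, by simpa [hsf] using hp, by simpa [hsf] using hp',
    fun e' he' => ?_⟩
  by_cases hef : e' = f
  · subst hef
    simp only [Function.update_self]
    rcases hx with ⟨e, he, rfl, rfl⟩ | ⟨hact, rfl⟩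
    · exact hrest e (not_sender e he)
    · exact Or.inr ⟨fun ⟨r, hr⟩ => hact ⟨a, r, hr⟩, rfl⟩
  · simpa [hef] using hrest e' he'

/-- **Lemma on resolving non-determinism.** If two processes are in the same waiting state
at time `j` and have the same next action state `q` (reached at times `j1 ≤ j2 < |ρ|`),
then one can modify the execution between `j+1` and `j2` so that both follow the
same path to `q`, reached at time `j1`. -/
theorem resolving_non_determinism {Q M : Type} [Fintype Q] [Fintype M]
    (P : Protocol Q M) (qu : Q)
    (hWO : P.WaitOnly) (hqu : P.Uncoverable qu)
    {n : ℕ} (ρ : Exec P n) (e1 e2 : Fin n) (j j1 j2 : ℕ) (q : Q)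
    (hj : (j : ℕ∞) < ρ.len)
    (heq : ρ.conf j e1 = ρ.conf j e2)
    (hwait : P.isWaiting (ρ.conf j e1))
    (h1 : Exec.next qu ρ j e1 = (q, (j1 : ℕ∞)))
    (h2 : Exec.next qu ρ j e2 = (q, (j2 : ℕ∞)))
    (hle : j1 ≤ j2) (hj2 : (j2 : ℕ∞) < ρ.len) :
    ∃ ρ' : Exec P n, ρ'.len = ρ.len ∧
      (∀ k : ℕ, k ≤ j → ρ'.conf k = ρ.conf k) ∧
      (∀ k : ℕ, j2 + 1 ≤ k → ρ'.conf k = ρ.conf k) ∧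
      (∀ k : ℕ, j + 1 ≤ k → k ≤ j1 →
        ρ'.conf k e1 = ρ.conf k e1 ∧ ρ'.conf k e2 = ρ.conf k e1) ∧
      (∀ k : ℕ, j1 < k → k ≤ j2 →
        ρ'.conf k e1 = ρ.conf k e1 ∧ ρ'.conf k e2 = q) ∧
      Exec.next qu ρ' j e1 = (q, (j1 : ℕ∞)) ∧
      Exec.next qu ρ' j e2 = (q, (j1 : ℕ∞)) := by
  classical
  have hj1 : (j1 : ℕ∞) < ρ.len := lt_of_le_of_lt (by exact_mod_cast hle) hj2
  obtain ⟨hjj1, hq1, hact, hw1⟩ := (Exec.next_eq_iff_of_lt qu ρ j j1 e1 q hj1).1 h1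
  obtain ⟨hjj2, hq2, -, hw2⟩ := (Exec.next_eq_iff_of_lt qu ρ j j2 e2 q hj2).1 h2
  let x : ℕ → Q := fun k => ρ.conf (min k j1) e1
  have x_lo : ∀ k, k ≤ j1 → x k = ρ.conf k e1 := fun k hk => by simp [x, hk]
  have x_hi : ∀ k, j1 ≤ k → x k = q := fun k hk => by simp [x, hk, hq1]
  let c : ℕ → Fin n → Q := fun k =>
    if j ≤ k ∧ k ≤ j2 then Function.update (ρ.conf k) e2 (x k) else ρ.conf k
  have c_mid : ∀ k, j ≤ k → k ≤ j2 → c k = Function.update (ρ.conf k) e2 (x k) :=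
    fun k hk hk' => if_pos ⟨hk, hk'⟩
  have c_lo : ∀ k, k ≤ j → c k = ρ.conf k := by
    intro k hk
    rcases hk.lt_or_eq with hk | rfl
    · exact if_neg (by omega)
    · rw [c_mid k le_rfl hjj2, x_lo k hjj1, heq, Function.update_eq_self]
  have c_hi : ∀ k, j2 ≤ k → c k = ρ.conf k := by
    intro k hk
    rcases hk.lt_or_eq with hk | rfl
    · exact if_neg (by omega)
    · rw [c_mid j2 hjj2 le_rfl, x_hi j2 hle, ← hq2, Function.update_eq_self]
  have c_e1 : ∀ k, c k e1 = ρ.conf k e1 := by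
    intro k
    by_cases he : e1 = e2
    · subst he
      have hj12 : j1 = j2 := by simpa using (Prod.ext_iff.1 (h1.symm.trans h2)).2
      by_cases hk : j ≤ k ∧ k ≤ j2
      · rw [c_mid k hk.1 hk.2, Function.update_self, x_lo k (hj12 ▸ hk.2)]
      · simp only [c, if_neg hk]
    · simp only [c]
      split_ifs <;> simp [he]
  have c_e2 : ∀ k, j ≤ k → k ≤ j2 → c k e2 = x k := fun k hk hk' => by
    rw [c_mid k hk hk', Function.update_self]
  have c_step : ∀ i : ℕ, ((i : ℕ∞) + 1) < ρ.len → P.StepAny (c i) (c (i + 1)) := by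
    intro i hi
    have hs := ρ.step i hi
    by_cases hlo : i + 1 ≤ j
    · rwa [c_lo i (by omega), c_lo (i + 1) hlo]
    by_cases hhi : j2 ≤ i
    · rwa [c_hi i hhi, c_hi (i + 1) (by omega)]
    rw [c_mid i (by omega) (by omega), c_mid (i + 1) (by omega) (by omega)]
    refine hs.update hWO (hw2 i (by omega) (by omega)) ?_
    rcases lt_or_ge i j1 with h | h
    · exact Or.inl ⟨e1, hw1 i (by omega) h, x_lo i h.le, x_lo (i + 1) h⟩
    · rw [x_hi i h, x_hi (i + 1) (by omega)]
      exact Or.inr ⟨hact, rfl⟩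
  let ρ' : Exec P n :=
    { npos := ρ.npos
      len := ρ.len
      len_pos := ρ.len_pos
      conf := c
      init := by rw [c_lo 0 (Nat.zero_le j)]; exact ρ.init
      step := c_step }
  refine ⟨ρ', rfl, c_lo, fun k hk => c_hi k (by omega), fun k hk hk' => ⟨c_e1 k, ?_⟩,
    fun k hk hk' => ⟨c_e1 k, ?_⟩, ?_, ?_⟩
  · exact (c_e2 k (by omega) (by omega)).trans (x_lo k hk')
  · exact (c_e2 k (by omega) hk').trans (x_hi k hk.le)
  · refine (Exec.next_eq_iff_of_lt qu ρ' j j1 e1 q hj1).2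
      ⟨hjj1, (c_e1 j1).trans hq1, hact, fun k hk hk' => ?_⟩
    change P.isWaiting (c k e1)
    rw [c_e1]
    exact hw1 k hk hk'
  · refine (Exec.next_eq_iff_of_lt qu ρ' j j1 e2 q hj1).2
      ⟨hjj1, (c_e2 j1 hjj1 hle).trans (x_hi j1 le_rfl), hact, fun k hk hk' => ?_⟩
    change P.isWaiting (c k e2)
    rw [c_e2 k hk (by omega), x_lo k hk'.le]
    exact hw1 k hk hk'
end

section
/- Let P = (Q, Σ, q_in, T) be a Wait-Only protocol and q_f ∈ Q. There exists a finite execution ρ = C_0 … C_n with C_n(e) = q_f for all e ∈ [1, nb(ρ)] if and only if there exists a well-formed execution from C_0 to C_n. -/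
set_option maxHeartbeats 1000000

namespace Protocol

variable {Q M : Type} {P : Protocol Q M}

lemma notMem_R_of_not_isWaiting {q : Q} (h : ¬ P.isWaiting q) (a : M) : a ∉ P.R q :=
  fun ⟨q', hq'⟩ => h ⟨a, q', hq'⟩

end Protocol

namespace Exec

variable {Q M : Type} {P : Protocol Q M} {n : ℕ} {qu : Q}

lemma nextIdx_of_not_isWaiting (ρ : Exec P n) {i : ℕ} {e : Fin n} (hi : (i : ℕ∞) < ρ.len)
    (h : ¬ P.isWaiting (ρ.conf i e)) : nextIdx ρ i e = i := by
  classical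
  have hex : ∃ k : ℕ, i ≤ k ∧ (k : ℕ∞) < ρ.len ∧ ¬ P.isWaiting (ρ.conf k e) :=
    ⟨i, le_rfl, hi, h⟩
  rw [nextIdx, dif_pos hex, Nat.cast_inj]
  exact le_antisymm (Nat.find_min' hex ⟨le_rfl, hi, h⟩) (Nat.find_spec hex).1

lemma nextSt_of_not_isWaiting (ρ : Exec P n) {i : ℕ} {e : Fin n} (hi : (i : ℕ∞) < ρ.len)
    (h : ¬ P.isWaiting (ρ.conf i e)) : nextSt qu ρ i e = ρ.conf i e := by
  classical
  have hex : ∃ k : ℕ, i ≤ k ∧ (k : ℕ∞) < ρ.len ∧ ¬ P.isWaiting (ρ.conf k e) :=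
    ⟨i, le_rfl, hi, h⟩
  rw [nextSt, dif_pos hex]
  congr 1
  exact le_antisymm (Nat.find_min' hex ⟨le_rfl, hi, h⟩) (Nat.find_spec hex).1

/-- An action state at or after `i` is at or after `i + 1` if the process waits at `i`. -/
lemma action_succ_iff (ρ : Exec P n) {i : ℕ} {e : Fin n}
    (h : P.isWaiting (ρ.conf i e)) (k : ℕ) :
    (i ≤ k ∧ (k : ℕ∞) < ρ.len ∧ ¬ P.isWaiting (ρ.conf k e)) ↔
      (i + 1 ≤ k ∧ (k : ℕ∞) < ρ.len ∧ ¬ P.isWaiting (ρ.conf k e)) := by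
  constructor
  · rintro ⟨hik, hk, hw⟩
    refine ⟨Nat.lt_of_le_of_ne hik ?_, hk, hw⟩
    rintro rfl
    exact hw h
  · rintro ⟨hik, hk, hw⟩
    exact ⟨by omega, hk, hw⟩

lemma nextIdx_succ (ρ : Exec P n) {i : ℕ} {e : Fin n} (h : P.isWaiting (ρ.conf i e)) :
    nextIdx ρ (i + 1) e = nextIdx ρ i e := by
  classical
  unfold nextIdx
  by_cases hex : ∃ k : ℕ, i ≤ k ∧ (k : ℕ∞) < ρ.len ∧ ¬ P.isWaiting (ρ.conf k e)
  · rw [dif_pos hex, dif_pos ((exists_congr (action_succ_iff ρ h)).1 hex)]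
    exact congrArg _ (Nat.find_congr' (action_succ_iff ρ h _).symm)
  · rw [dif_neg hex, dif_neg (mt (exists_congr (action_succ_iff ρ h)).2 hex)]

lemma nextSt_succ (ρ : Exec P n) {i : ℕ} {e : Fin n} (h : P.isWaiting (ρ.conf i e)) :
    nextSt qu ρ (i + 1) e = nextSt qu ρ i e := by
  classical
  unfold nextSt
  by_cases hex : ∃ k : ℕ, i ≤ k ∧ (k : ℕ∞) < ρ.len ∧ ¬ P.isWaiting (ρ.conf k e)
  · rw [dif_pos hex, dif_pos ((exists_congr (action_succ_iff ρ h)).1 hex)]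
    exact congrArg (ρ.conf · e) (Nat.find_congr' (action_succ_iff ρ h _).symm)
  · rw [dif_neg hex, dif_neg (mt (exists_congr (action_succ_iff ρ h)).2 hex)]

lemma isWaiting_of_lt_nextIdx (ρ : Exec P n) {i k : ℕ} {e : Fin n} (hik : i ≤ k)
    (hk : (k : ℕ∞) < ρ.len) (h : (k : ℕ∞) < nextIdx ρ i e) : P.isWaiting (ρ.conf k e) := by
  classical
  by_contra hw
  have hex : ∃ k : ℕ, i ≤ k ∧ (k : ℕ∞) < ρ.len ∧ ¬ P.isWaiting (ρ.conf k e) :=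
    ⟨k, hik, hk, hw⟩
  rw [nextIdx, dif_pos hex, Nat.cast_lt] at h
  exact Nat.find_min hex h ⟨hik, hk, hw⟩

lemma lt_nextIdx_of_isWaiting (ρ : Exec P n) {i : ℕ} {e : Fin n} (hi : (i : ℕ∞) < ρ.len)
    (h : P.isWaiting (ρ.conf i e)) : (i : ℕ∞) < nextIdx ρ i e := by
  classical
  unfold nextIdx
  split_ifs with hex
  · rw [Nat.cast_lt]
    refine lt_of_le_of_ne (Nat.find_spec hex).1 fun heq => (Nat.find_spec hex).2.2 ?_
    rwa [← heq]
  · exact hi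

lemma nextSt_last_of_isWaiting (ρ : Exec P n) {L : ℕ} (hL : ρ.len = (L : ℕ∞) + 1) {e : Fin n}
    (h : P.isWaiting (ρ.conf L e)) : nextSt qu ρ L e = qu := by
  rw [nextSt, dif_neg]
  rintro ⟨k, hLk, hk, hw⟩
  rw [hL] at hk
  have hk' : k < L + 1 := by exact_mod_cast hk
  obtain rfl : k = L := by omega
  exact hw h

lemma conf_ne_of_uncoverable (ρ : Exec P n) (hqu : P.Uncoverable qu) (i : ℕ)
    (hi : (i : ℕ∞) < ρ.len) (e : Fin n) : ρ.conf i e ≠ qu := by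
  induction i generalizing e with
  | zero => rw [ρ.init e]; exact hqu.2.symm
  | succ i ih =>
    obtain ⟨b, t, q, a, q', rfl, ht, -, hb', hrest⟩ := ρ.step i (by exact_mod_cast hi)
    by_cases he : e = b
    · rw [he, hb']; exact (hqu.1 _ _ _ ht).2
    · rcases hrest e he with h | ⟨-, h⟩
      · exact (hqu.1 _ _ _ h).2
      · rw [h]
        exact ih (lt_of_le_of_lt (by exact_mod_cast Nat.le_succ i) hi) e

/-- `f` is in state `q` at time `i`, has next action state `s`, and reaches it no later than any
other such process. -/
def IsLeader (qu : Q) (ρ : Exec P n) (i : ℕ) (q s : Q) (f : Fin n) : Prop :=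
  (ρ.conf i f = q ∧ nextSt qu ρ i f = s) ∧
    ∀ g, ρ.conf i g = q ∧ nextSt qu ρ i g = s → nextIdx ρ i f ≤ nextIdx ρ i g

lemma exists_isLeader (ρ : Exec P n) {i : ℕ} {q s : Q} {g : Fin n}
    (hg : ρ.conf i g = q ∧ nextSt qu ρ i g = s) : ∃ f, IsLeader qu ρ i q s f := by
  obtain ⟨f, hf, hmin⟩ := Set.exists_min_image
    {f | ρ.conf i f = q ∧ nextSt qu ρ i f = s} (nextIdx ρ i) (Set.toFinite _) ⟨g, hg⟩
  exact ⟨f, hf, hmin⟩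

/-- A chosen leader, if there is one. -/
noncomputable def leader (qu : Q) (ρ : Exec P n) (i : ℕ) (q s : Q) : Fin n :=
  haveI : Nonempty (Fin n) := ⟨⟨0, ρ.npos⟩⟩
  Classical.epsilon (IsLeader qu ρ i q s)

lemma isLeader_leader (ρ : Exec P n) {i : ℕ} {q s : Q} {g : Fin n}
    (hg : ρ.conf i g = q ∧ nextSt qu ρ i g = s) : IsLeader qu ρ i q s (leader qu ρ i q s) :=
  Classical.epsilon_spec (exists_isLeader ρ hg)

open Classical in
/-- Configurations of the execution in which waiting processes follow their leader in `ρ` and then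
stay in the action state reached until they do so in `ρ`; constant from index `L` on. -/
noncomputable def mergedConf (qu : Q) (ρ : Exec P n) (L : ℕ) : ℕ → Fin n → Q
  | 0 => ρ.conf 0
  | i + 1 => fun e =>
    if L ≤ i then mergedConf qu ρ L i e
    else if P.isWaiting (ρ.conf i e) then
      if P.isWaiting (mergedConf qu ρ L i e) then
        ρ.conf (i + 1) (leader qu ρ i (mergedConf qu ρ L i e) (nextSt qu ρ i e))
      else mergedConf qu ρ L i e
    else ρ.conf (i + 1) e

section Merged

variable (ρ : Exec P n) {L : ℕ}

lemma mergedConf_succ_of_le {i : ℕ} (h : L ≤ i) (e : Fin n) :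
    mergedConf qu ρ L (i + 1) e = mergedConf qu ρ L i e := by
  simp [mergedConf, h]

lemma mergedConf_succ_of_action {i : ℕ} (h : i < L) {e : Fin n}
    (hw : ¬ P.isWaiting (ρ.conf i e)) :
    mergedConf qu ρ L (i + 1) e = ρ.conf (i + 1) e := by
  simp [mergedConf, not_le.2 h, hw]

lemma mergedConf_succ_of_isWaiting {i : ℕ} (h : i < L) {e : Fin n}
    (hw : P.isWaiting (ρ.conf i e)) (hw' : P.isWaiting (mergedConf qu ρ L i e)) :
    mergedConf qu ρ L (i + 1) e =
      ρ.conf (i + 1) (leader qu ρ i (mergedConf qu ρ L i e) (nextSt qu ρ i e)) := by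
  simp [mergedConf, not_le.2 h, hw, hw']

lemma mergedConf_succ_of_arrived {i : ℕ} (h : i < L) {e : Fin n}
    (hw : P.isWaiting (ρ.conf i e)) (hw' : ¬ P.isWaiting (mergedConf qu ρ L i e)) :
    mergedConf qu ρ L (i + 1) e = mergedConf qu ρ L i e := by
  simp [mergedConf, not_le.2 h, hw, hw']

lemma mergedConf_inv (hL : ρ.len = (L : ℕ∞) + 1) (i : ℕ) (hi : i ≤ L) (e : Fin n) :
    (P.isWaiting (mergedConf qu ρ L i e) → ∃ f, ρ.conf i f = mergedConf qu ρ L i e ∧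
      nextSt qu ρ i f = nextSt qu ρ i e ∧ nextIdx ρ i f ≤ nextIdx ρ i e) ∧
    (¬ P.isWaiting (mergedConf qu ρ L i e) → mergedConf qu ρ L i e = nextSt qu ρ i e) := by
  have hlen : ∀ j ≤ L, (j : ℕ∞) < ρ.len := fun j hj => by
    rw [hL]; exact_mod_cast Nat.lt_succ_of_le hj
  induction i with
  | zero =>
    exact ⟨fun _ => ⟨e, rfl, rfl, le_rfl⟩,
      fun h => (nextSt_of_not_isWaiting ρ (hlen 0 hi) h).symm⟩
  | succ i ih =>
    have hi' : i < L := hi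
    obtain ⟨ih1, ih2⟩ := ih hi'.le
    by_cases hw : P.isWaiting (ρ.conf i e)
    · by_cases hw' : P.isWaiting (mergedConf qu ρ L i e)
      · obtain ⟨g, hg, hgs, hgi⟩ := ih1 hw'
        obtain ⟨⟨hf, hfs⟩, hmin⟩ := isLeader_leader ρ ⟨hg, hgs⟩
        rw [mergedConf_succ_of_isWaiting ρ hi' hw hw']
        generalize leader qu ρ i (mergedConf qu ρ L i e) (nextSt qu ρ i e) = f at hf hfs hmin ⊢
        have hwf : P.isWaiting (ρ.conf i f) := by rwa [hf]
        rw [nextSt_succ ρ hw, ← hfs, ← nextSt_succ ρ hwf, nextIdx_succ ρ hw]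
        refine ⟨fun _ => ⟨f, rfl, rfl, ?_⟩,
          fun h => (nextSt_of_not_isWaiting ρ (hlen _ hi) h).symm⟩
        rw [nextIdx_succ ρ hwf]
        exact (hmin g ⟨hg, hgs⟩).trans hgi
      · rw [mergedConf_succ_of_arrived ρ hi' hw hw', nextSt_succ ρ hw]
        exact ⟨fun h => absurd h hw', ih2⟩
    · rw [mergedConf_succ_of_action ρ hi' hw]
      exact ⟨fun _ => ⟨e, rfl, rfl, le_rfl⟩,
        fun h => (nextSt_of_not_isWaiting ρ (hlen _ hi) h).symm⟩

lemma mergedConf_eq_of_action (hL : ρ.len = (L : ℕ∞) + 1) {i : ℕ} (hi : i ≤ L) {e : Fin n}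
    (hw : ¬ P.isWaiting (ρ.conf i e)) : mergedConf qu ρ L i e = ρ.conf i e := by
  have hlt : (i : ℕ∞) < ρ.len := by rw [hL]; exact_mod_cast Nat.lt_succ_of_le hi
  obtain ⟨h1, h2⟩ := mergedConf_inv (qu := qu) ρ hL i hi e
  by_cases hw' : P.isWaiting (mergedConf qu ρ L i e)
  · obtain ⟨f, hf, -, hle⟩ := h1 hw'
    rw [nextIdx_of_not_isWaiting ρ hlt hw] at hle
    exact absurd (lt_nextIdx_of_isWaiting ρ hlt (by rwa [hf])) (not_lt.2 hle)
  · rw [h2 hw', nextSt_of_not_isWaiting ρ hlt hw]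

lemma isWaiting_of_mergedConf (hL : ρ.len = (L : ℕ∞) + 1) {i : ℕ} (hi : i ≤ L) {e : Fin n}
    (hw : P.isWaiting (mergedConf qu ρ L i e)) : P.isWaiting (ρ.conf i e) := by
  by_contra h
  rw [mergedConf_eq_of_action ρ hL hi h] at hw
  exact h hw

lemma mergedConf_step (hWO : P.WaitOnly) (hL : ρ.len = (L : ℕ∞) + 1) {i : ℕ} (hi : i < L) :
    P.StepAny (mergedConf qu ρ L i) (mergedConf qu ρ L (i + 1)) := by
  obtain ⟨b, t, q, a, q', rfl, ht, hb, hb', hrest⟩ := ρ.step i (by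
    rw [hL]; exact_mod_cast Nat.succ_lt_succ hi)
  have hwb : ¬ P.isWaiting (ρ.conf i b) := by
    rw [hb]
    exact (hWO.1 q).resolve_right fun h => h ⟨a, q', ht⟩
  refine ⟨b, _, q, a, q', rfl, ht, ?_, ?_, fun e he => ?_⟩
  · rw [mergedConf_eq_of_action ρ hL hi.le hwb, hb]
  · rw [mergedConf_succ_of_action ρ hi hwb, hb']
  by_cases hw : P.isWaiting (ρ.conf i e)
  · by_cases hw' : P.isWaiting (mergedConf qu ρ L i e)
    · obtain ⟨g, hg, hgs, -⟩ := (mergedConf_inv ρ hL i hi.le e).1 hw'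
      obtain ⟨⟨hf, -⟩, -⟩ := isLeader_leader ρ ⟨hg, hgs⟩
      rw [mergedConf_succ_of_isWaiting ρ hi hw hw']
      generalize leader qu ρ i (mergedConf qu ρ L i e) (nextSt qu ρ i e) = f at hf ⊢
      rw [← hf] at hw' ⊢
      refine hrest f ?_
      rintro rfl
      exact hwb hw'
    · rw [mergedConf_succ_of_arrived ρ hi hw hw']
      exact Or.inr ⟨P.notMem_R_of_not_isWaiting hw' a, rfl⟩
  · rw [mergedConf_succ_of_action ρ hi hw, mergedConf_eq_of_action ρ hL hi.le hw]
    exact hrest e he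

/-- The execution running through `mergedConf`. -/
noncomputable def merged (qu : Q) (hWO : P.WaitOnly) (ρ : Exec P n) (L : ℕ)
    (hL : ρ.len = (L : ℕ∞) + 1) : Exec P n where
  npos := ρ.npos
  len := ρ.len
  len_pos := ρ.len_pos
  conf := mergedConf qu ρ L
  init := ρ.init
  step i hi := mergedConf_step ρ hWO hL (by
    rw [hL] at hi
    have : i + 1 < L + 1 := by exact_mod_cast hi
    omega)

lemma isWaiting_last_of_merged (hWO : P.WaitOnly) (hL : ρ.len = (L : ℕ∞) + 1)
    (hqu : P.Uncoverable qu) {e : Fin n}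
    (h : P.isWaiting (ρ.conf L e)) : P.isWaiting (mergedConf qu ρ L L e) := by
  by_contra hw
  refine conf_ne_of_uncoverable (merged qu hWO ρ L hL) hqu L ?_ e ?_
  · change (L : ℕ∞) < ρ.len
    rw [hL]; exact_mod_cast Nat.lt_succ_self L
  · exact ((mergedConf_inv ρ hL L le_rfl e).2 hw).trans (nextSt_last_of_isWaiting ρ hL h)

lemma nextSt_merged (hWO : P.WaitOnly) (hL : ρ.len = (L : ℕ∞) + 1)
    (i : ℕ) (hi : i ≤ L) (e : Fin n) :
    nextSt qu (merged qu hWO ρ L hL) i e = nextSt qu ρ i e := by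
  induction hi using Nat.decreasingInduction with
  | of_succ i hi ih =>
    by_cases hw : P.isWaiting (mergedConf qu ρ L i e)
    · rw [← nextSt_succ ρ (isWaiting_of_mergedConf ρ hL (Nat.le_of_lt hi) hw), ← ih]
      exact (nextSt_succ (merged qu hWO ρ L hL) hw).symm
    · rw [← (mergedConf_inv ρ hL i (Nat.le_of_lt hi) e).2 hw]
      refine nextSt_of_not_isWaiting (merged qu hWO ρ L hL) ?_ hw
      change (i : ℕ∞) < ρ.len
      rw [hL]; exact_mod_cast Nat.lt_succ_of_lt hi
  | self =>
    by_cases hw : P.isWaiting (mergedConf qu ρ L L e)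
    · rw [nextSt_last_of_isWaiting ρ hL (isWaiting_of_mergedConf ρ hL le_rfl hw)]
      exact nextSt_last_of_isWaiting (merged qu hWO ρ L hL) hL hw
    · rw [← (mergedConf_inv ρ hL L le_rfl e).2 hw]
      refine nextSt_of_not_isWaiting (merged qu hWO ρ L hL) ?_ hw
      change (L : ℕ∞) < ρ.len
      rw [hL]; exact_mod_cast Nat.lt_succ_self L

lemma wellFormed_merged (hWO : P.WaitOnly) (hL : ρ.len = (L : ℕ∞) + 1) :
    WellFormed qu (merged qu hWO ρ L hL) := by
  intro i hi e1 e2 heq _ hst k hik hk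
  have hiL : i ≤ L := by
    change (i : ℕ∞) < ρ.len at hi
    rw [hL] at hi
    have : i < L + 1 := by exact_mod_cast hi
    omega
  rw [nextSt_merged ρ hWO hL i hiL, nextSt_merged ρ hWO hL i hiL] at hst
  suffices h : mergedConf qu ρ L k e1 = mergedConf qu ρ L k e2 ∧
      (k ≤ L → nextSt qu ρ k e1 = nextSt qu ρ k e2) from h.1
  induction k, hik using Nat.le_induction with
  | base => exact ⟨heq, fun _ => hst⟩
  | succ k hik ih =>
    have hk' : (k : ℕ∞) < nextIdx (merged qu hWO ρ L hL) i e1 :=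
      lt_of_lt_of_le (by exact_mod_cast Nat.lt_succ_self k) hk
    obtain ⟨ihc, ihs⟩ := ih hk'.le
    rcases le_or_gt L k with hLk | hkL
    · rw [mergedConf_succ_of_le ρ hLk, mergedConf_succ_of_le ρ hLk]
      exact ⟨ihc, fun h => by omega⟩
    · have hw1 : P.isWaiting (mergedConf qu ρ L k e1) :=
        isWaiting_of_lt_nextIdx (merged qu hWO ρ L hL) hik (by
          change (k : ℕ∞) < ρ.len
          rw [hL]; exact_mod_cast Nat.lt_succ_of_lt hkL) hk'
      have hw2 : P.isWaiting (mergedConf qu ρ L k e2) := ihc ▸ hw1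
      have hr1 := isWaiting_of_mergedConf ρ hL hkL.le hw1
      have hr2 := isWaiting_of_mergedConf ρ hL hkL.le hw2
      rw [mergedConf_succ_of_isWaiting ρ hkL hr1 hw1, mergedConf_succ_of_isWaiting ρ hkL hr2 hw2,
        nextSt_succ ρ hr1, nextSt_succ ρ hr2, ihc, ihs hkL.le]
      exact ⟨rfl, fun _ => rfl⟩

lemma mergedConf_last (hWO : P.WaitOnly) (hL : ρ.len = (L : ℕ∞) + 1) (hqu : P.Uncoverable qu)
    {qf : Q} (hqf : ∀ e, ρ.conf L e = qf) : mergedConf qu ρ L L = ρ.conf L := by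
  funext e
  by_cases hw : P.isWaiting (ρ.conf L e)
  · obtain ⟨f, hf, -⟩ := (mergedConf_inv ρ hL L le_rfl e).1
      (isWaiting_last_of_merged ρ hWO hL hqu hw)
    rw [← hf, hqf, hqf]
  · exact mergedConf_eq_of_action ρ hL le_rfl hw

end Merged

end Exec

/-- **Restriction to well-formed executions.** For a Wait-Only protocol `P` and a state
`q_f`, there exists a finite execution `ρ = C_0 … C_L` with `C_L(e) = q_f` for all
processes `e` if and only if there exists a well-formed execution from `C_0` to `C_L`. -/
theorem well_formed_equivalence {Q M : Type} [Fintype Q] [Fintype M]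
    (P : Protocol Q M) (qu qf : Q)
    (hWO : P.WaitOnly) (hqu : P.Uncoverable qu)
    {n : ℕ} (C0 Cn : Fin n → Q) (hqf : ∀ e, Cn e = qf) :
    (∃ (ρ : Exec P n) (L : ℕ), ρ.len = (L : ℕ∞) + 1 ∧ ρ.conf 0 = C0 ∧ ρ.conf L = Cn) ↔
    (∃ (ρ : Exec P n) (L : ℕ), Exec.WellFormed qu ρ ∧ ρ.len = (L : ℕ∞) + 1 ∧
      ρ.conf 0 = C0 ∧ ρ.conf L = Cn) := by
  constructor
  · rintro ⟨ρ, L, hL, h0, hn⟩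
    refine ⟨Exec.merged qu hWO ρ L hL, L, Exec.wellFormed_merged ρ hWO hL, hL, h0, ?_⟩
    rw [← hn]
    exact Exec.mergedConf_last ρ hWO hL hqu fun e => by rw [hn, hqf]
  · rintro ⟨ρ, L, -, h⟩
    exact ⟨ρ, L, h⟩
end

section
/- Let P = (Q, Σ, q_in, T) be a Wait-Only protocol. For every well-formed execution ρ, every index 0 ≤ j < |ρ| and every action state q_a ∈ Q_A, the set nextSet(ρ, j, q_a) has at most |Q_W| elements. -/
set_option maxHeartbeats 1000000

namespace Exec

variable {Q M : Type} {P : Protocol Q M} {n : ℕ}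

theorem nextIdx_le_of_not_isWaiting (ρ : Exec P n) {j k : ℕ} {e : Fin n} (hjk : j ≤ k)
    (hk : (k : ℕ∞) < ρ.len) (hw : ¬ P.isWaiting (ρ.conf k e)) : ρ.nextIdx j e ≤ k := by
  classical
  have h : ∃ k : ℕ, j ≤ k ∧ (k : ℕ∞) < ρ.len ∧ ¬ P.isWaiting (ρ.conf k e) := ⟨k, hjk, hk, hw⟩
  rw [nextIdx, dif_pos h]
  exact_mod_cast Nat.find_min' h ⟨hjk, hk, hw⟩

theorem nextIdx_le_len (ρ : Exec P n) (j : ℕ) (e : Fin n) : ρ.nextIdx j e ≤ ρ.len := by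
  classical
  by_cases h : ∃ k : ℕ, j ≤ k ∧ (k : ℕ∞) < ρ.len ∧ ¬ P.isWaiting (ρ.conf k e)
  · rw [nextIdx, dif_pos h]
    exact (Nat.find_spec h).2.1.le
  · rw [nextIdx, dif_neg h]

theorem nextIdx_le_nextIdx (ρ : Exec P n) {j : ℕ} {e₁ e₂ : Fin n}
    (h : ∀ k : ℕ, j ≤ k → (k : ℕ∞) ≤ ρ.nextIdx j e₁ → ρ.conf k e₁ = ρ.conf k e₂) :
    ρ.nextIdx j e₂ ≤ ρ.nextIdx j e₁ := by
  classical
  by_cases h₁ : ∃ k : ℕ, j ≤ k ∧ (k : ℕ∞) < ρ.len ∧ ¬ P.isWaiting (ρ.conf k e₁)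
  · have hidx : ρ.nextIdx j e₁ = (Nat.find h₁ : ℕ∞) := by rw [nextIdx, dif_pos h₁]
    obtain ⟨hj, hlen, hw⟩ := Nat.find_spec h₁
    rw [h _ hj hidx.ge] at hw
    exact (nextIdx_le_of_not_isWaiting ρ hj hlen hw).trans hidx.ge
  · have hidx : ρ.nextIdx j e₁ = ρ.len := by rw [nextIdx, dif_neg h₁]
    exact hidx ▸ nextIdx_le_len ρ j e₂

/-- In a well-formed execution, processes in the same waiting state with the same next action
state reach it at the same time. -/
theorem WellFormed.nextIdx_eq {qu : Q} {ρ : Exec P n} (hwf : WellFormed qu ρ) {j : ℕ}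
    (hj : (j : ℕ∞) < ρ.len) {e₁ e₂ : Fin n} (he : ρ.conf j e₁ = ρ.conf j e₂)
    (hw : P.isWaiting (ρ.conf j e₁)) (hst : nextSt qu ρ j e₁ = nextSt qu ρ j e₂) :
    ρ.nextIdx j e₁ = ρ.nextIdx j e₂ :=
  le_antisymm (nextIdx_le_nextIdx ρ (hwf j hj e₂ e₁ he.symm (he ▸ hw) hst.symm))
    (nextIdx_le_nextIdx ρ (hwf j hj e₁ e₂ he hw hst))

end Exec

/-- **Bound on next-action index sets.** In a well-formed execution of a Wait-Only
protocol, for every index `j < |ρ|` and every action state `q_a`, the set of indices at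
which waiting processes reach `q_a` has at most `|Q_W|` elements. -/
theorem nextSet_card_le {Q M : Type} [Fintype Q] [Fintype M]
    (P : Protocol Q M) (qu : Q)
    (hWO : P.WaitOnly) (hqu : P.Uncoverable qu)
    {n : ℕ} (ρ : Exec P n) (hwf : Exec.WellFormed qu ρ)
    (j : ℕ) (hj : (j : ℕ∞) < ρ.len)
    (qa : Q) (hqa : qa ∈ P.QA) :
    (Exec.nextSet qu ρ j qa).encard ≤ P.QW.encard := by
  have : Nonempty (Fin n) := ⟨⟨0, ρ.npos⟩⟩
  have hex : ∀ i ∈ Exec.nextSet qu ρ j qa, ∃ e : Fin n,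
      P.isWaiting (ρ.conf j e) ∧ Exec.next qu ρ j e = (qa, (i : ℕ∞)) := fun _ hi => hi
  choose! e hw hnext using hex
  refine Set.encard_le_encard_of_injOn (f := fun i => ρ.conf j (e i)) hw fun i hi i' hi' h => ?_
  obtain ⟨hst, hidx⟩ := Prod.mk.inj (hnext i hi)
  obtain ⟨hst', hidx'⟩ := Prod.mk.inj (hnext i' hi')
  have := hwf.nextIdx_eq hj h (hw i hi) (hst.trans hst'.symm)
  rw [hidx, hidx'] at this
  exact_mod_cast this
end

section
/- Let P be a Wait-Only protocol with uncoverable state q_u and final state q_f ∈ Q_W, and let V_P be the associated VASS. Let λ, λ' be S-configurations of V_P and C ∈ ⟦λ⟧. If λ ⇝ λ' in V_P, then there exists a protocol configuration C' ∈ ⟦λ'⟧ such that C →* C' in P. -/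
set_option maxHeartbeats 1000000

structure VASS (L X : Type) where
  init : L
  Δ : Set (L × (X → ℤ) × L)

namespace VASS

variable {L X : Type}

/-- One VASS step (counters stay in ℕ by typing). -/
def Step (V : VASS L X) (c c' : L × (X → ℕ)) : Prop :=
  ∃ δ, (c.1, δ, c'.1) ∈ V.Δ ∧ ∀ x, (c'.2 x : ℤ) = (c.2 x : ℤ) + δ x

def Reach (V : VASS L X) : (L × (X → ℕ)) → (L × (X → ℕ)) → Prop :=
  Relation.ReflTransGen V.Step

end VASS

/-- A summary: a print (set of waiting states), an exit state and an identifier. -/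
structure Summary (Q : Type) where
  pr : Set Q
  exit : Q
  id : ℕ

namespace BP

variable {Q M : Type}

/-- `|Q_W|`. -/
noncomputable def nW (P : Protocol Q M) : ℕ := P.QW.ncard

def ValidSummary (P : Protocol Q M) (S : Summary Q) : Prop :=
  S.pr ⊆ P.QW ∧ S.exit ∈ P.QA ∧ 1 ≤ S.id ∧ S.id ≤ nW P + 1

/-- Coherent sets of summaries. -/
def Coherent (P : Protocol Q M) (SS : Set (Summary Q)) : Prop :=
  (∀ S ∈ SS, ValidSummary P S) ∧
  ∀ S1 ∈ SS, ∀ S2 ∈ SS, S1 ≠ S2 → S1.exit = S2.exit →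
    S1.id ≠ S2.id ∧ S1.pr ∩ S2.pr = ∅

/-- Labels of a set of summaries. -/
def labs (SS : Set (Summary Q)) : Set (Q × ℕ) := (fun S => (S.exit, S.id)) '' SS

/-- `σ` describes a legal reaction of each state of `pr` to the broadcast of `b`. -/
def RecvFun (P : Protocol Q M) (b : M) (pr : Set Q) (σ : Q → Q) : Prop :=
  ∀ p ∈ pr, (p, Act.recv b, σ p) ∈ P.T ∨ (b ∉ P.R p ∧ σ p = p)

/-- `S ⟶^t S'`. -/
def SummStep (P : Protocol Q M) (t : Q × Act M × Q) (S S' : Summary Q) : Prop :=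
  ∃ q b q', t = (q, Act.send b, q') ∧ t ∈ P.T ∧
    ∃ σ : Q → Q, RecvFun P b S.pr σ ∧ S'.exit = S.exit ∧ S'.id = S.id ∧
      S'.pr = σ '' S.pr ∧ σ '' S.pr ⊆ P.QW

/-- `S ⟶^{t,+q'} S'`. -/
def SummStepJoin (P : Protocol Q M) (t : Q × Act M × Q) (S S' : Summary Q) : Prop :=
  ∃ q b q', t = (q, Act.send b, q') ∧ t ∈ P.T ∧ q' ∈ P.QW ∧
    ∃ σ : Q → Q, RecvFun P b S.pr σ ∧ S'.exit = S.exit ∧ S'.id = S.id ∧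
      S'.pr = σ '' S.pr ∪ {q'} ∧ σ '' S.pr ∪ {q'} ⊆ P.QW

/-- `S ⟶^t Done`. -/
def SummStepDone (P : Protocol Q M) (t : Q × Act M × Q) (S : Summary Q) : Prop :=
  ∃ q b q', t = (q, Act.send b, q') ∧ t ∈ P.T ∧
    ∃ σ : Q → Q, RecvFun P b S.pr σ ∧ σ '' S.pr = {S.exit}

/-- `S` steps to `some S'` or to `Done` (encoded as `none`). -/
def stepsTo (P : Protocol Q M) (t : Q × Act M × Q) (S : Summary Q) :
    Option (Summary Q) → Prop
  | some S' => SummStep P t S S'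
  | none => SummStepDone P t S

inductive CtrBase (Q : Type) where
  | st : Q → CtrBase Q
  | sm : Q → ℕ → CtrBase Q

def ValidCtr (P : Protocol Q M) : CtrBase Q → Prop
  | .st q => q ∈ P.QA
  | .sm q k => q ∈ P.QA ∧ 1 ≤ k ∧ k ≤ nW P + 1

/-- The counters of the VASS built from `P`. -/
abbrev Ctr (P : Protocol Q M) := {x : CtrBase Q // ValidCtr P x}

open Classical in
/-- Characteristic (unit) vector of a counter. -/
noncomputable def chi (P : Protocol Q M) (x : CtrBase Q) : Ctr P → ℤ :=
  fun y => if y.val = x then 1 else 0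

/-- The relation `(SS, δ, SS') ∈ Δ_t`. -/
def DeltaT (P : Protocol Q M) (t : Q × Act M × Q) (SS : Set (Summary Q))
    (δ : Ctr P → ℤ) (SS' : Set (Summary Q)) : Prop :=
  Coherent P SS ∧ Coherent P SS' ∧
  ∃ q a q', t = (q, Act.send a, q') ∧ t ∈ P.T ∧
  ((q' ∈ P.QA ∧
      (∃ g : Summary Q → Option (Summary Q),
        (∀ S ∈ SS, stepsTo P t S (g S)) ∧
        SS' = {S' | ∃ S ∈ SS, g S = some S'}) ∧
      δ = fun y => chi P (.st q') y - chi P (.st q) y) ∨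
   (q' ∈ P.QW ∧
      ∃ S0 ∈ SS, ∃ S0' : Summary Q, SummStepJoin P t S0 S0' ∧
      (∃ g : Summary Q → Option (Summary Q),
        (∀ S ∈ SS, S ≠ S0 → stepsTo P t S (g S)) ∧
        SS' = insert S0' {S' | ∃ S ∈ SS, S ≠ S0 ∧ g S = some S'}) ∧
      δ = fun y => chi P (.sm S0.exit S0.id) y - chi P (.st q) y) ∨
   (q' ∈ P.QW ∧
      ∃ qa ∈ P.QA, ∃ k : ℕ, 1 ≤ k ∧ k ≤ nW P + 1 ∧ (qa, k) ∉ labs SS ∧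
      (∃ g : Summary Q → Option (Summary Q),
        (∀ S ∈ SS, stepsTo P t S (g S)) ∧
        SS' = insert (Summary.mk {q'} qa k) {S' | ∃ S ∈ SS, g S = some S'}) ∧
      δ = fun y => chi P (.sm qa k) y - chi P (.st q) y))

/-- The relation `(SS, δ, SS) ∈ Δ_e`. -/
def DeltaE (P : Protocol Q M) (SS : Set (Summary Q)) (δ : Ctr P → ℤ) : Prop :=
  Coherent P SS ∧ ∃ q ∈ P.QA, ∃ k : ℕ, 1 ≤ k ∧ k ≤ nW P + 1 ∧ (q, k) ∉ labs SS ∧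
    δ = fun y => chi P (.st q) y - chi P (.sm q k) y

/-- Locations of the VASS `V_P` (final state a waiting state). -/
inductive LocW (Q : Type) where
  | s0 : LocW Q
  | sf : LocW Q
  | co : Set (Summary Q) → LocW Q

/-- The VASS `V_P` associated to `P`, `q_u`, and a final waiting state `q_f`. -/
noncomputable def VP (P : Protocol Q M) (qu qf : Q) : VASS (LocW Q) (Ctr P) where
  init := .s0
  Δ := {d |
    d = (.s0, chi P (.st P.qin), .s0) ∨
    d = (.s0, 0, .co ∅) ∨
    d = (LocW.co {Summary.mk {qf} qu 1}, 0, .sf) ∨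
    d = (.sf, fun y => -(chi P (.sm qu 1) y), .sf) ∨
    (∃ t SS δ SS', d = (.co SS, δ, .co SS') ∧ DeltaT P t SS δ SS') ∨
    (∃ SS δ, d = (.co SS, δ, .co SS) ∧ DeltaE P SS δ)}

/-- `C ∈ ⟦(SS, v)⟧`. -/
def Implements (P : Protocol Q M) (SS : Set (Summary Q)) (v : Ctr P → ℕ)
    {n : ℕ} (C : Fin n → Q) : Prop :=
  ∃ f : Fin n → Ctr P,
    (∀ x : Ctr P, {e : Fin n | f e = x}.ncard = v x) ∧
    (∀ e q, (f e).val = CtrBase.st q → C e = q) ∧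
    (∀ e q k pr, (f e).val = CtrBase.sm q k → Summary.mk pr q k ∈ SS → C e ∈ pr ∪ {q}) ∧
    (∀ e q k, (f e).val = CtrBase.sm q k → (q, k) ∉ labs SS → C e = q)

end BP


namespace BP

variable {Q M : Type}

/-- A process in state `c` may be counted by the counter `x` at location `SS`. -/
def CountableAs (SS : Set (Summary Q)) (x : CtrBase Q) (c : Q) : Prop :=
  (∀ q, x = CtrBase.st q → c = q) ∧
  (∀ q k pr, x = CtrBase.sm q k → Summary.mk pr q k ∈ SS → c ∈ pr ∪ {q}) ∧
  (∀ q k, x = CtrBase.sm q k → (q, k) ∉ labs SS → c = q)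

lemma implements_iff {P : Protocol Q M} {SS : Set (Summary Q)} {v : Ctr P → ℕ} {n : ℕ}
    {C : Fin n → Q} :
    Implements P SS v C ↔ ∃ f : Fin n → Ctr P,
      (∀ x : Ctr P, {e : Fin n | f e = x}.ncard = v x) ∧ ∀ e, CountableAs SS (f e).val (C e) := by
  constructor
  · rintro ⟨f, h, h1, h2, h3⟩
    exact ⟨f, h, fun e => ⟨h1 e, h2 e, h3 e⟩⟩
  · rintro ⟨f, h, hf⟩
    exact ⟨f, h, fun e => (hf e).1, fun e => (hf e).2.1, fun e => (hf e).2.2⟩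

lemma countableAs_st (SS : Set (Summary Q)) (q : Q) : CountableAs SS (.st q) q :=
  ⟨fun _ h => by cases h; rfl, fun _ _ _ h => (by cases h), fun _ _ h => (by cases h)⟩

lemma countableAs_sm_exit (SS : Set (Summary Q)) (q : Q) (k : ℕ) : CountableAs SS (.sm q k) q :=
  ⟨fun _ h => (by cases h), fun _ _ _ h _ => by cases h; simp, fun _ _ h _ => by cases h; rfl⟩

lemma Coherent.eq_of_label {P : Protocol Q M} {SS : Set (Summary Q)} (h : Coherent P SS)
    {S₁ S₂ : Summary Q} (h₁ : S₁ ∈ SS) (h₂ : S₂ ∈ SS) (he : S₁.exit = S₂.exit)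
    (hid : S₁.id = S₂.id) : S₁ = S₂ := by
  by_contra hne
  exact (h.2 _ h₁ _ h₂ hne he).1 hid

lemma Coherent.countableAs_sm {P : Protocol Q M} {SS : Set (Summary Q)} (h : Coherent P SS)
    {S : Summary Q} (hS : S ∈ SS) {c : Q} (hc : c ∈ S.pr) : CountableAs SS (.sm S.exit S.id) c := by
  refine ⟨fun _ h => (by cases h), ?_, ?_⟩
  · rintro q k pr hx hmem
    cases hx
    have hpr : S.pr = pr := congrArg Summary.pr (h.eq_of_label hS hmem rfl rfl)
    exact Or.inl (hpr ▸ hc)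
  · rintro q k hx hl
    cases hx
    exact absurd ⟨S, hS, rfl⟩ hl

lemma chi_self {P : Protocol Q M} (x : Ctr P) : chi P x.val x = 1 := if_pos rfl

lemma chi_of_ne {P : Protocol Q M} {x z : Ctr P} (h : z ≠ x) : chi P x.val z = 0 :=
  if_neg fun h' => h (Subtype.ext h')

/-- Moving one process from counter `x` to a different counter `y` changes the counts by
`chi y - chi x`. -/
lemma ncard_update {P : Protocol Q M} {n : ℕ} {f : Fin n → Ctr P} {v v' : Ctr P → ℕ}
    (hf : ∀ z, {e : Fin n | f e = z}.ncard = v z) {x y : Ctr P} (hxy : x ≠ y)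
    (hv : ∀ z, (v' z : ℤ) = v z + (chi P y.val z - chi P x.val z))
    {e : Fin n} (he : f e = x) (z : Ctr P) :
    {e' : Fin n | Function.update f e y e' = z}.ncard = v' z := by
  have hz := hv z
  have hfz := hf z
  rcases eq_or_ne z y with rfl | hzy
  · have hset : {e' : Fin n | Function.update f e z e' = z} = insert e {e' | f e' = z} := by
      ext e'
      by_cases h : e' = e <;> simp [Function.update_apply, h]
    have hnot : e ∉ {e' | f e' = z} := by simpa [he] using hxy
    rw [hset, Set.ncard_insert_of_notMem hnot, hfz]
    rw [chi_self, chi_of_ne hxy.symm] at hz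
    omega
  · rcases eq_or_ne z x with rfl | hzx
    · have hset : {e' : Fin n | Function.update f e y e' = z} = {e' | f e' = z} \ {e} := by
        ext e'
        by_cases h : e' = e <;> simp [Function.update_apply, h, hzy.symm]
      rw [hset, Set.ncard_sdiff_singleton_of_mem (by exact he), hfz]
      rw [chi_self, chi_of_ne hzy] at hz
      omega
    · have hset : {e' : Fin n | Function.update f e y e' = z} = {e' | f e' = z} := by
        ext e'
        by_cases h : e' = e
        · subst h
          simp [he, hzy.symm, hzx.symm]
        · simp [h]
      rw [hset, hfz]
      rw [chi_of_ne hzx, chi_of_ne hzy] at hz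
      omega

lemma exists_counted {P : Protocol Q M} {n : ℕ} {f : Fin n → Ctr P} {v v' : Ctr P → ℕ}
    (hf : ∀ z, {e : Fin n | f e = z}.ncard = v z) {x y : Ctr P} (hxy : x ≠ y)
    (hv : ∀ z, (v' z : ℤ) = v z + (chi P y.val z - chi P x.val z)) : ∃ e, f e = x := by
  have hx := hv x
  rw [chi_self, chi_of_ne hxy] at hx
  have hne : {e : Fin n | f e = x}.ncard ≠ 0 := by
    rw [hf]
    omega
  exact Set.nonempty_of_ncard_ne_zero hne

/-- `SS'` accounts for a possible reaction of the print of `S` to the broadcast of `a`. -/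
def Tracks (P : Protocol Q M) (a : M) (SS' : Set (Summary Q)) (S : Summary Q) : Prop :=
  ∃ σ : Q → Q, RecvFun P a S.pr σ ∧
    ((∃ S' ∈ SS', S'.exit = S.exit ∧ S'.id = S.id ∧ σ '' S.pr ⊆ S'.pr) ∨ σ '' S.pr ⊆ {S.exit})

lemma tracks_of_stepsTo {P : Protocol Q M} {q q' : Q} {a : M} {SS' : Set (Summary Q)}
    {S : Summary Q} {o : Option (Summary Q)} (h : stepsTo P (q, .send a, q') S o)
    (ho : ∀ S', o = some S' → S' ∈ SS') : Tracks P a SS' S := by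
  cases o with
  | none =>
    obtain ⟨_, _, _, ht, -, σ, hσ, him⟩ := h
    cases ht
    exact ⟨σ, hσ, Or.inr him.subset⟩
  | some S' =>
    obtain ⟨_, _, _, ht, -, σ, hσ, hex, hid, hpr, -⟩ := h
    cases ht
    exact ⟨σ, hσ, Or.inl ⟨S', ho S' rfl, hex, hid, hpr.symm.subset⟩⟩

/-- Every process other than the broadcaster has a legal reaction compatible with its counter. -/
lemma exists_reaction {P : Protocol Q M} {a : M} {SS SS' : Set (Summary Q)}
    (hco' : Coherent P SS') (hT : ∀ S ∈ SS, Tracks P a SS' S) (x : Ctr P) {c : Q}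
    (hc : CountableAs SS x.val c) :
    ∃ c', ((c, Act.recv a, c') ∈ P.T ∨ (a ∉ P.R c ∧ c' = c)) ∧ CountableAs SS' x.val c' := by
  have hidle : ∀ q ∈ P.QA, a ∉ P.R q := fun q hq ⟨q', h⟩ => hq ⟨a, q', h⟩
  obtain ⟨x, hx⟩ := x
  cases x with
  | st q =>
    obtain rfl := hc.1 q rfl
    exact ⟨c, Or.inr ⟨hidle c hx, rfl⟩, countableAs_st _ _⟩
  | sm q k =>
    by_cases hcq : c = q
    · subst hcq
      exact ⟨c, Or.inr ⟨hidle c hx.1, rfl⟩, countableAs_sm_exit _ _ _⟩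
    · have hl : (q, k) ∈ labs SS := by
        by_contra hl
        exact hcq (hc.2.2 q k rfl hl)
      obtain ⟨⟨pr, q₁, k₁⟩, hS, hlab⟩ := hl
      cases hlab
      have hpr : c ∈ pr := (hc.2.1 _ _ pr rfl hS).resolve_right hcq
      obtain ⟨σ, hσ, ⟨S', hS', hex, hid, him⟩ | him⟩ := hT _ hS
      · refine ⟨σ c, hσ c hpr, ?_⟩
        have hcount := hco'.countableAs_sm hS' (him ⟨c, hpr, rfl⟩)
        rwa [hex, hid] at hcount
      · refine ⟨σ c, hσ c hpr, ?_⟩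
        have hexit : σ c = q₁ := him ⟨c, hpr, rfl⟩
        rw [hexit]
        exact countableAs_sm_exit _ _ _

lemma implements_broadcast {P : Protocol Q M} {q q' : Q} {a : M} (ht : (q, .send a, q') ∈ P.T)
    {SS SS' : Set (Summary Q)} {v v' : Ctr P → ℕ} (hco' : Coherent P SS') {n : ℕ}
    {C : Fin n → Q} (hC : Implements P SS v C) (hT : ∀ S ∈ SS, Tracks P a SS' S)
    {x y : Ctr P} (hx : x.val = .st q) (hxy : x ≠ y) (hy : CountableAs SS' y.val q')
    (hv : ∀ z, (v' z : ℤ) = v z + (chi P y.val z - chi P x.val z)) :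
    ∃ C' : Fin n → Q, Implements P SS' v' C' ∧ P.Reach C C' := by
  obtain ⟨f, hf, hcount⟩ := implements_iff.1 hC
  obtain ⟨e, he⟩ := exists_counted hf hxy hv
  choose D hD hDcount using fun e' => exists_reaction hco' hT (f e') (hcount e')
  refine ⟨Function.update D e q', implements_iff.2
    ⟨Function.update f e y, ncard_update hf hxy hv he, fun e' => ?_⟩,
    .single ⟨e, _, q, a, q', rfl, ht, (hcount e).1 q (he ▸ hx), by simp, fun e' hne => ?_⟩⟩
  · by_cases h : e' = e
    · subst h
      simpa using hy
    · simpa [h] using hDcount e'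
  · simpa [hne] using hD e'

lemma implements_deltaE {P : Protocol Q M} {SS : Set (Summary Q)} {v v' : Ctr P → ℕ} {n : ℕ}
    {C : Fin n → Q} (hC : Implements P SS v C) {δ : Ctr P → ℤ} (hδ : DeltaE P SS δ)
    (hv : ∀ z, (v' z : ℤ) = v z + δ z) : Implements P SS v' C := by
  obtain ⟨-, q, hq, k, hk, hk', hl, rfl⟩ := hδ
  obtain ⟨f, hf, hcount⟩ := implements_iff.1 hC
  let x : Ctr P := ⟨.sm q k, hq, hk, hk'⟩
  let y : Ctr P := ⟨.st q, hq⟩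
  have hxy : x ≠ y := fun h => by cases congrArg Subtype.val h
  obtain ⟨e, he⟩ := exists_counted (x := x) (y := y) hf hxy hv
  refine implements_iff.2 ⟨Function.update f e y, ncard_update hf hxy hv he, fun e' => ?_⟩
  by_cases h : e' = e
  · subst h
    have hCe : C e' = q := (hcount e').2.2 q k (by rw [he]) hl
    simpa [hCe] using countableAs_st SS q
  · simpa [h] using hcount e'

lemma implements_deltaT {P : Protocol Q M} (hWO : P.WaitOnly) {t : Q × Act M × Q}
    {SS SS' : Set (Summary Q)} {v v' : Ctr P → ℕ} {n : ℕ} {C : Fin n → Q}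
    (hC : Implements P SS v C) {δ : Ctr P → ℤ} (hδ : DeltaT P t SS δ SS')
    (hv : ∀ z, (v' z : ℤ) = v z + δ z) :
    ∃ C' : Fin n → Q, Implements P SS' v' C' ∧ P.Reach C C' := by
  obtain ⟨hco, hco', q, a, q', rfl, ht, hcase⟩ := hδ
  have hq : q ∈ P.QA := (hWO.1 q).resolve_right fun h => h ⟨a, q', ht⟩
  have hne : q ≠ q' := by
    rintro rfl
    exact hWO.2.2 _ _ ht
  let x : Ctr P := ⟨.st q, hq⟩
  have hsm : ∀ p k (h : ValidCtr P (.sm p k)), x ≠ ⟨.sm p k, h⟩ :=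
    fun _ _ _ h => by cases congrArg Subtype.val h
  rcases hcase with ⟨hq', ⟨g, hg, rfl⟩, rfl⟩ | ⟨-, S₀, hS₀, S₀', hjoin, ⟨g, hg, rfl⟩, rfl⟩ |
    ⟨-, qa, hqa, k, hk, hk', -, ⟨g, hg, rfl⟩, rfl⟩
  · refine implements_broadcast (x := x) (y := ⟨.st q', hq'⟩) ht hco' hC
      (fun S hS => tracks_of_stepsTo (hg S hS) fun S' h => ⟨S, hS, h⟩) rfl ?_ (countableAs_st _ _) hv
    intro h
    cases congrArg Subtype.val h
    exact hne rfl
  · obtain ⟨_, _, _, heq, -, -, σ, hσ, hex, hid, hpr, -⟩ := hjoin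
    cases heq
    have hlab := (hco.1 S₀ hS₀).2
    refine implements_broadcast (x := x) (y := ⟨.sm S₀.exit S₀.id, hlab⟩) ht hco' hC
      (fun S hS => ?_) rfl (hsm _ _ _) ?_ hv
    · by_cases h : S = S₀
      · subst h
        exact ⟨σ, hσ, Or.inl ⟨S₀', Set.mem_insert _ _, hex, hid, hpr ▸ Set.subset_union_left⟩⟩
      · exact tracks_of_stepsTo (hg S hS h) fun S' h' => Or.inr ⟨S, hS, h, h'⟩
    · have hcount := hco'.countableAs_sm (Set.mem_insert S₀' _) (c := q') (hpr ▸ Or.inr rfl)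
      rwa [hex, hid] at hcount
  · exact implements_broadcast (x := x) (y := ⟨.sm qa k, hqa, hk, hk'⟩) ht hco' hC
      (fun S hS => tracks_of_stepsTo (hg S hS) fun S' h => Or.inr ⟨S, hS, h⟩) rfl (hsm _ _ _)
      (hco'.countableAs_sm (Set.mem_insert _ _) (c := q') rfl) hv

end BP

open BP in
/-- **Soundness of one VASS step.** If `λ ⇝ λ'` in `V_P` between S-configurations and
`C` implements `λ`, then some `C'` implementing `λ'` is reachable from `C` in `P`. -/
theorem vass_step_soundness {Q M : Type} [Fintype Q] [Fintype M]
    (P : Protocol Q M) (qu qf : Q)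
    (hWO : P.WaitOnly) (hqu : P.Uncoverable qu) (hqf : qf ∈ P.QW)
    (SS SS' : Set (Summary Q)) (v v' : Ctr P → ℕ)
    (hco : Coherent P SS) (hco' : Coherent P SS')
    {n : ℕ} (hn : 0 < n) (C : Fin n → Q)
    (hC : Implements P SS v C)
    (hstep : (VP P qu qf).Step (LocW.co SS, v) (LocW.co SS', v')) :
    ∃ C' : Fin n → Q, Implements P SS' v' C' ∧ P.Reach C C' := by
  obtain ⟨δ, hδ, hv⟩ := hstep
  rcases hδ with h | h | h | h | ⟨t, SS₁, δ₁, SS₂, h, hT⟩ | ⟨SS₁, δ₁, h, hE⟩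
  · cases h
  · cases h
  · cases h
  · cases h
  · cases h
    exact implements_deltaT hWO hC hT hv
  · cases h
    exact ⟨C, implements_deltaE hC hE hv, .refl⟩
end

section
/- Let P be a Wait-Only protocol with uncoverable state q_u and final state q_f ∈ Q_W, and let V_P be the associated VASS. If there exist an initial configuration C of P and a configuration C' such that C →* C' and C'(e) = q_f for all e ∈ [1, ||C'||], then (s_0, 0) ⇝* (s_f, 0) in V_P. -/
set_option maxHeartbeats 1000000

namespace BP

variable {Q M : Type} {n : ℕ}

section Paths

/-- First moment `k ≥ j` at which the path `π` is in an action state. -/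
noncomputable def arrival (P : Protocol Q M) (π : ℕ → Q) (j : ℕ) : ℕ :=
  sInf {k | j ≤ k ∧ ¬ P.isWaiting (π k)}

/-- First action state visited by the path `π` from moment `j` on. -/
noncomputable def exitSt (P : Protocol Q M) (π : ℕ → Q) (j : ℕ) : Q := π (arrival P π j)

variable {P : Protocol Q M} {π : ℕ → Q} {j : ℕ}

theorem arrival_of_action (h : ¬ P.isWaiting (π j)) : arrival P π j = j :=
  le_antisymm (Nat.sInf_le ⟨le_rfl, h⟩) (le_csInf ⟨j, le_rfl, h⟩ fun _ hk => hk.1)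

theorem exitSt_of_action (h : ¬ P.isWaiting (π j)) : exitSt P π j = π j := by
  rw [exitSt, arrival_of_action h]

theorem arrival_succ (h : P.isWaiting (π j)) : arrival P π (j + 1) = arrival P π j := by
  unfold arrival
  congr 1
  ext k
  simp only [Set.mem_ofPred_eq]
  constructor
  · rintro ⟨h1, h2⟩
    exact ⟨by omega, h2⟩
  · rintro ⟨h1, h2⟩
    refine ⟨?_, h2⟩
    rcases h1.eq_or_lt with rfl | h1
    · exact absurd h h2
    · exact h1

theorem exitSt_succ (h : P.isWaiting (π j)) : exitSt P π (j + 1) = exitSt P π j := by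
  rw [exitSt, exitSt, arrival_succ h]

theorem arrival_mem (h : ∃ k, j ≤ k ∧ ¬ P.isWaiting (π k)) :
    j ≤ arrival P π j ∧ ¬ P.isWaiting (exitSt P π j) :=
  Nat.sInf_mem (s := {k | j ≤ k ∧ ¬ P.isWaiting (π k)}) h

theorem arrival_le {k : ℕ} (hjk : j ≤ k) (h : ¬ P.isWaiting (π k)) : arrival P π j ≤ k :=
  Nat.sInf_le ⟨hjk, h⟩

theorem lt_arrival (h : ∃ k, j ≤ k ∧ ¬ P.isWaiting (π k)) (hw : P.isWaiting (π j)) :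
    j < arrival P π j := by
  obtain ⟨h1, h2⟩ := arrival_mem h
  refine lt_of_le_of_ne h1 fun he => h2 ?_
  rw [exitSt, ← he]
  exact hw

end Paths

theorem not_isWaiting_of_send {P : Protocol Q M} (hWO : P.WaitOnly) {q q' : Q} {a : M}
    (h : (q, Act.send a, q') ∈ P.T) : ¬ P.isWaiting q :=
  (hWO.1 q).resolve_right fun h' => h' ⟨a, q', h⟩

theorem not_isWaiting_of_uncoverable {P : Protocol Q M} {qu : Q} (hqu : P.Uncoverable qu) :
    ¬ P.isWaiting qu := fun ⟨_, _, h⟩ => (hqu.1 _ _ _ h).1 rfl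

/-- A well-formed execution of length `m`, continued after its end by the uncoverable state:
processes in the same waiting state with the same exit state move together. -/
structure WFRun (P : Protocol Q M) (qu : Q) (m : ℕ) (D : ℕ → Fin n → Q) : Prop where
  step : ∀ j < m, P.StepAny (D j) (D (j + 1))
  tail : ∀ j > m, ∀ e, D j e = qu
  ne_qu : ∀ j ≤ m, ∀ e, D j e ≠ qu
  together : ∀ j e₁ e₂, D j e₁ = D j e₂ → P.isWaiting (D j e₁) →
    exitSt P (D · e₁) j = exitSt P (D · e₂) j → D (j + 1) e₁ = D (j + 1) e₂

theorem ne_uncoverable_of_steps {P : Protocol Q M} {qu : Q} (hqu : P.Uncoverable qu) {m : ℕ}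
    {D : ℕ → Fin n → Q} (h0 : ∀ e, D 0 e = P.qin)
    (hstep : ∀ j < m, P.StepAny (D j) (D (j + 1))) :
    ∀ j ≤ m, ∀ e, D j e ≠ qu := by
  intro j
  induction j with
  | zero => intro _ e; rw [h0]; exact hqu.2.symm
  | succ j ih =>
    intro hj e
    obtain ⟨e₀, _, q, a, q', rfl, ht, -, h2, h3⟩ := hstep j hj
    by_cases he : e = e₀
    · rw [he, h2]
      exact (hqu.1 _ _ _ ht).2
    · rcases h3 e he with h | ⟨-, h⟩
      · exact (hqu.1 _ _ _ h).2
      · rw [h]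
        exact ih (by omega) e

theorem exists_run {P : Protocol Q M} {C C' : Fin n → Q} (qu : Q) (h : P.Reach C C') :
    ∃ m, ∃ D : ℕ → Fin n → Q, D 0 = C ∧ D m = C' ∧
      (∀ j < m, P.StepAny (D j) (D (j + 1))) ∧ ∀ j > m, ∀ e, D j e = qu := by
  induction h using Relation.ReflTransGen.head_induction_on with
  | refl =>
    exact ⟨0, fun j => if j = 0 then C' else fun _ => qu, by simp, by simp, by simp,
      fun j hj e => by simp [Nat.ne_of_gt hj]⟩
  | @head A B hAB _ ih =>
    obtain ⟨m, D, h0, hm, hs, ht⟩ := ih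
    refine ⟨m + 1, fun j => Nat.casesOn j A D, rfl, hm, ?_, ?_⟩
    · rintro (_ | j) hj
      · change P.StepAny A (D 0)
        rwa [h0]
      · exact hs j (by omega)
    · rintro (_ | j) hj e
      · omega
      · exact ht j (by omega) e

/-- Among the processes in a given state with a given exit state one can pick one that
leaves the waiting states first. -/
theorem exists_leader (P : Protocol Q M) [NeZero n] (C : ℕ → Fin n → Q) (j : ℕ) (p x : Q) :
    ∃ c : Fin n, ∀ e, C j e = p → exitSt P (C · e) j = x →
      C j c = p ∧ exitSt P (C · c) j = x ∧ arrival P (C · c) j ≤ arrival P (C · e) j := by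
  classical
  by_cases h : (Finset.univ.filter
      fun e : Fin n => C j e = p ∧ exitSt P (C · e) j = x).Nonempty
  · obtain ⟨c, hc, hmin⟩ := Finset.exists_min_image _ (fun e => arrival P (C · e) j) h
    simp only [Finset.mem_filter, Finset.mem_univ, true_and] at hc hmin
    exact ⟨c, fun e h1 h2 => ⟨hc.1, hc.2, hmin e ⟨h1, h2⟩⟩⟩
  · refine ⟨0, fun e h1 h2 => absurd ⟨e, ?_⟩ h⟩
    simp [h1, h2]

open Classical in
/-- The execution in which a waiting process follows the leader for its state and exit state,
and then idles in its exit state until the original process gets there. -/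
noncomputable def follow (P : Protocol Q M) (C : ℕ → Fin n → Q) (c : ℕ → Q → Q → Fin n) :
    ℕ → Fin n → Q
  | 0, e => C 0 e
  | j + 1, e =>
    if P.isWaiting (follow P C c j e) then
      C (j + 1) (c j (follow P C c j e) (exitSt P (C · e) j))
    else if P.isWaiting (C j e) then follow P C c j e else C (j + 1) e

section Follow

variable {P : Protocol Q M} {qu : Q} {m : ℕ} {C : ℕ → Fin n → Q} {c : ℕ → Q → Q → Fin n}

theorem follow_spec
    (htail : ∀ j e, ∃ k, j ≤ k ∧ ¬ P.isWaiting (C k e))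
    (hc : ∀ j p x e, C j e = p → exitSt P (C · e) j = x → C j (c j p x) = p ∧
      exitSt P (C · (c j p x)) j = x ∧ arrival P (C · (c j p x)) j ≤ arrival P (C · e) j)
    (j : ℕ) (e : Fin n) :
    follow P C c j e = exitSt P (C · e) j ∨
      P.isWaiting (C j e) ∧ ∃ e', follow P C c j e = C j e' ∧ P.isWaiting (C j e') ∧
        exitSt P (C · e') j = exitSt P (C · e) j ∧
        arrival P (C · e') j ≤ arrival P (C · e) j := by
  induction j with
  | zero =>
    by_cases hw : P.isWaiting (C 0 e)
    · exact Or.inr ⟨hw, e, rfl, hw, rfl, le_rfl⟩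
    · exact Or.inl (exitSt_of_action (π := (C · e)) hw).symm
  | succ j ih =>
    rw [follow]
    rcases ih with ih | ⟨hw, e', h1, hw', hx, ha⟩
    · have hn : ¬ P.isWaiting (follow P C c j e) := by
        rw [ih]; exact (arrival_mem (htail j e)).2
      rw [if_neg hn]
      by_cases hw : P.isWaiting (C j e)
      · rw [if_pos hw, ih]
        exact Or.inl (exitSt_succ (π := (C · e)) hw).symm
      · rw [if_neg hw]
        by_cases hw' : P.isWaiting (C (j + 1) e)
        · exact Or.inr ⟨hw', e, rfl, hw', rfl, le_rfl⟩
        · exact Or.inl (exitSt_of_action (π := (C · e)) hw').symm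
    · rw [if_pos (h1 ▸ hw')]
      obtain ⟨hc1, hc2, hc3⟩ := hc j _ _ e' h1.symm hx
      set d := c j (follow P C c j e) (exitSt P (C · e) j)
      have hwd : P.isWaiting (C j d) := by rw [hc1, h1]; exact hw'
      have hxd := exitSt_succ (π := (C · d)) hwd
      have had := arrival_succ (π := (C · d)) hwd
      have hxe := exitSt_succ (π := (C · e)) hw
      have hae := arrival_succ (π := (C · e)) hw
      by_cases hwd' : P.isWaiting (C (j + 1) d)
      · right
        refine ⟨?_, d, rfl, hwd', by rw [hxd, hxe, hc2], by rw [had, hae]; omega⟩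
        by_contra hne
        have h2 := arrival_of_action (π := (C · e)) hne
        have h3 := lt_arrival (htail (j + 1) d) hwd'
        omega
      · left
        rw [hxe, ← hc2, ← hxd]
        exact (exitSt_of_action (π := (C · d)) hwd').symm

theorem exists_wfRun (hWO : P.WaitOnly) (hqu : P.Uncoverable qu) [NeZero n] {qf : Q}
    (h0 : ∀ e, C 0 e = P.qin) (hm : ∀ e, C m e = qf) (hqf : P.isWaiting qf)
    (hstep : ∀ j < m, P.StepAny (C j) (C (j + 1))) (htl : ∀ j > m, ∀ e, C j e = qu) :
    ∃ D : ℕ → Fin n → Q, (∀ e, D 0 e = P.qin) ∧ (∀ e, D m e = qf) ∧ WFRun P qu m D := by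
  choose c hc using exists_leader P C
  have htail : ∀ j e, ∃ k, j ≤ k ∧ ¬ P.isWaiting (C k e) := fun j e =>
    ⟨j + m + 1, by omega, by
      rw [htl _ (by omega)]; exact not_isWaiting_of_uncoverable hqu⟩
  have hspec := follow_spec htail hc
  set D := follow P C c with hD
  have hD0 : ∀ e, D 0 e = P.qin := fun e => by rw [hD, follow, h0]
  have hDstep : ∀ j < m, P.StepAny (D j) (D (j + 1)) := by
    intro j hj
    obtain ⟨e₀, _, q, a, q', rfl, ht, h1, h2, h3⟩ := hstep j hj
    have hq : ¬ P.isWaiting (C j e₀) := h1 ▸ not_isWaiting_of_send hWO ht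
    have hDq : D j e₀ = C j e₀ := by
      rcases hspec j e₀ with h | ⟨h, -⟩
      · rw [h]; exact exitSt_of_action (π := (C · e₀)) hq
      · exact absurd h hq
    refine ⟨e₀, _, q, a, q', rfl, ht, hDq.trans h1, ?_, ?_⟩
    · have hDq' : ¬ P.isWaiting (D j e₀) := hDq ▸ hq
      rw [hD, follow, if_neg hDq', if_neg hq, h2]
    · intro e he
      by_cases hw : P.isWaiting (D j e)
      · rw [hD, follow, if_pos hw]
        rcases hspec j e with h | ⟨-, e', h4, h5, h6, -⟩
        · exact absurd hw (h ▸ (arrival_mem (htail j e)).2)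
        · have hcc := (hc j _ _ e' h4.symm h6).1
          have hne : c j (D j e) (exitSt P (C · e) j) ≠ e₀ := by
            intro h
            rw [h] at hcc
            exact hq (hcc ▸ hw)
          have := h3 _ hne
          rwa [hcc] at this
      · right
        refine ⟨fun ⟨q, h⟩ => hw ⟨a, q, h⟩, ?_⟩
        rw [hD, follow, if_neg hw]
        split_ifs with hw'
        · rfl
        · have hDe : D j e = C j e := by
            rcases hspec j e with h | ⟨h, -⟩
            · rw [h]; exact exitSt_of_action (π := (C · e)) hw'
            · exact absurd h hw'
          rcases h3 e he with h | ⟨-, h⟩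
          · exact absurd ⟨a, _, h⟩ hw'
          · rw [h]; exact hDe.symm
  have hne := ne_uncoverable_of_steps hqu hD0 hDstep
  have htlD : ∀ j > m, ∀ e, D j e = qu := by
    intro j hj e
    have hnw : ¬ P.isWaiting (C j e) := by
      rw [htl j hj]; exact not_isWaiting_of_uncoverable hqu
    rcases hspec j e with h | ⟨h, -⟩
    · rw [h, ← htl j hj e]; exact exitSt_of_action (π := (C · e)) hnw
    · exact absurd h hnw
  have hexit : ∀ j e, P.isWaiting (D j e) → exitSt P (D · e) j = exitSt P (C · e) j := by
    have key : ∀ d j e, m + 1 - j = d → P.isWaiting (D j e) →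
        exitSt P (D · e) j = exitSt P (C · e) j := by
      intro d
      induction d with
      | zero =>
        intro j e hd hw
        rw [htlD j (by omega)] at hw
        exact absurd hw (not_isWaiting_of_uncoverable hqu)
      | succ d ih =>
        intro j e hd hw
        have hCw : P.isWaiting (C j e) := by
          rcases hspec j e with h | ⟨h, -⟩
          · exact absurd hw (h ▸ (arrival_mem (htail j e)).2)
          · exact h
        rw [← exitSt_succ (π := (D · e)) hw, ← exitSt_succ (π := (C · e)) hCw]
        by_cases hw' : P.isWaiting (D (j + 1) e)
        · exact ih (j + 1) e (by omega) hw'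
        · rw [exitSt_of_action (π := (D · e)) hw']
          rcases hspec (j + 1) e with h | ⟨-, e', h, h', -⟩
          · exact h
          · exact absurd (h ▸ h') hw'
    exact fun j e => key _ j e rfl
  refine ⟨D, hD0, fun e => ?_, hDstep, htlD, hne, ?_⟩
  · rcases hspec m e with h | ⟨-, e', h, -⟩
    · refine absurd ?_ (hne m le_rfl e)
      have hw : P.isWaiting (C m e) := by rw [hm]; exact hqf
      have hnw : ¬ P.isWaiting (C (m + 1) e) := by
        rw [htl _ (by omega)]; exact not_isWaiting_of_uncoverable hqu
      rw [h, ← exitSt_succ (π := (C · e)) hw, exitSt_of_action (π := (C · e)) hnw]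
      exact htl _ (by omega) e
    · rw [h, hm]
  · intro j e₁ e₂ h hw hx
    rw [hexit j e₁ hw, hexit j e₂ (h ▸ hw)] at hx
    simp only [hD, follow]
    rw [← hD, if_pos hw, if_pos (h ▸ hw), hx, h]

end Follow

section Counters

variable {P : Protocol Q M}

open Classical in
/-- Counter values obtained by placing each process `e` on the counter `f e`. -/
noncomputable def cnt (P : Protocol Q M) (f : Fin n → CtrBase Q) : Ctr P → ℕ :=
  fun x => ∑ e, if x.1 = f e then 1 else 0

theorem cast_cnt (f : Fin n → CtrBase Q) (x : Ctr P) :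
    (cnt P f x : ℤ) = ∑ e, chi P (f e) x := by
  simp [cnt, chi]

theorem cnt_update (f : Fin n → CtrBase Q) (e : Fin n) (y : CtrBase Q) (x : Ctr P) :
    (cnt P (Function.update f e y) x : ℤ) =
      (cnt P f x : ℤ) + (chi P y x - chi P (f e) x) := by
  rw [cast_cnt, cast_cnt, ← Finset.add_sum_erase _ _ (Finset.mem_univ e),
    ← Finset.add_sum_erase _ (fun e => chi P (f e) x) (Finset.mem_univ e),
    Finset.sum_congr rfl (g := fun e => chi P (f e) x)]
  · simp only [Function.update_self]; ring
  · intro e' he'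
    rw [Function.update_of_ne (Finset.ne_of_mem_erase he')]

/-- Processes whose summary is over can be moved to the counter of their exit state. -/
theorem reach_drain {qu qf : Q} {SS : Set (Summary Q)} (hSS : Coherent P SS)
    (f g : Fin n → CtrBase Q)
    (h : ∀ e, f e = g e ∨ ∃ q ∈ P.QA, ∃ k, 1 ≤ k ∧ k ≤ nW P + 1 ∧ (q, k) ∉ labs SS ∧
      f e = .sm q k ∧ g e = .st q) :
    (VP P qu qf).Reach (.co SS, cnt P f) (.co SS, cnt P g) := by
  classical
  have key : ∀ s : Finset (Fin n),
      (VP P qu qf).Reach (.co SS, cnt P f) (.co SS, cnt P (s.piecewise g f)) := by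
    intro s
    induction s using Finset.induction_on with
    | empty => rw [Finset.piecewise_empty]; exact .refl
    | insert e s he ih =>
      rw [Finset.piecewise_insert]
      have hfe : s.piecewise g f e = f e := Finset.piecewise_eq_of_notMem _ _ _ he
      rcases h e with h | ⟨q, hq, k, h1, h2, h3, h4, h5⟩
      · rwa [← h, ← hfe, Function.update_eq_self]
      · refine ih.tail ⟨fun y => chi P (.st q) y - chi P (.sm q k) y,
          Or.inr <| Or.inr <| Or.inr <| Or.inr <| Or.inr
            ⟨SS, _, rfl, hSS, q, hq, k, h1, h2, h3, rfl⟩, fun x => ?_⟩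
        rw [cnt_update, hfe, h4, h5]
  simpa using key Finset.univ

end Counters

section Simulation

/-- Exit state and arrival time of process `e` at moment `j`. -/
noncomputable def key (P : Protocol Q M) (D : ℕ → Fin n → Q) (j : ℕ) (e : Fin n) : Q × ℕ :=
  (exitSt P (D · e) j, arrival P (D · e) j)

/-- Keys of the waiting processes. -/
def active (P : Protocol Q M) (D : ℕ → Fin n → Q) (j : ℕ) : Set (Q × ℕ) :=
  {κ | ∃ e, P.isWaiting (D j e) ∧ key P D j e = κ}

/-- States of the waiting processes of key `κ`. -/
def print (P : Protocol Q M) (D : ℕ → Fin n → Q) (j : ℕ) (κ : Q × ℕ) : Set Q :=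
  {p | ∃ e, P.isWaiting (D j e) ∧ key P D j e = κ ∧ D j e = p}

/-- The summary of the waiting processes of key `κ`, with identifiers given by `ι`. -/
def summ (P : Protocol Q M) (D : ℕ → Fin n → Q) (ι : Q × ℕ → ℕ) (j : ℕ) (κ : Q × ℕ) :
    Summary Q := ⟨print P D j κ, κ.1, ι κ⟩

/-- The set of summaries describing the configuration at moment `j`. -/
def loc (P : Protocol Q M) (D : ℕ → Fin n → Q) (ι : Q × ℕ → ℕ) (j : ℕ) : Set (Summary Q) :=
  summ P D ι j '' active P D j

open Classical in
/-- The counter on which process `e` is placed at moment `j`. -/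
noncomputable def ctr (P : Protocol Q M) (D : ℕ → Fin n → Q) (ι : Q × ℕ → ℕ) (j : ℕ)
    (e : Fin n) : CtrBase Q :=
  if P.isWaiting (D j e) then .sm (key P D j e).1 (ι (key P D j e)) else .st (D j e)

/-- Admissible assignments of identifiers to the keys active at moment `j`. -/
structure GoodIds (P : Protocol Q M) (qu : Q) (D : ℕ → Fin n → Q) (ι : Q × ℕ → ℕ) (j : ℕ) :
    Prop where
  pos : ∀ κ ∈ active P D j, 1 ≤ ι κ
  le : ∀ κ ∈ active P D j, ι κ ≤ nW P + 1
  inj : ∀ κ ∈ active P D j, ∀ κ' ∈ active P D j, κ.1 = κ'.1 → ι κ = ι κ' → κ = κ'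
  qu : ∀ κ ∈ active P D j, κ.1 = qu → ι κ = 1

variable {P : Protocol Q M} {qu : Q} {m : ℕ} {D : ℕ → Fin n → Q} {ι ι' : Q × ℕ → ℕ} {j : ℕ}

theorem key_succ {e : Fin n} (h : P.isWaiting (D j e)) : key P D (j + 1) e = key P D j e := by
  rw [key, key, exitSt_succ (π := (D · e)) h, arrival_succ (π := (D · e)) h]

theorem key_of_action {e : Fin n} (h : ¬ P.isWaiting (D j e)) : key P D j e = (D j e, j) := by
  rw [key, exitSt_of_action (π := (D · e)) h, arrival_of_action (π := (D · e)) h]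

theorem summ_injOn (hι : GoodIds P qu D ι j) : Set.InjOn (summ P D ι j) (active P D j) :=
  fun κ hκ κ' hκ' h => hι.inj κ hκ κ' hκ' (congrArg Summary.exit h) (congrArg Summary.id h)

theorem mem_labs_loc {q : Q} {k : ℕ} :
    (q, k) ∈ labs (loc P D ι j) ↔ ∃ κ ∈ active P D j, κ.1 = q ∧ ι κ = k := by
  simp only [labs, loc, Set.mem_image, summ, Prod.mk.injEq]
  constructor
  · rintro ⟨_, ⟨κ, hκ, rfl⟩, h1, h2⟩
    exact ⟨κ, hκ, h1, h2⟩
  · rintro ⟨κ, hκ, h1, h2⟩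
    exact ⟨_, ⟨κ, hκ, rfl⟩, h1, h2⟩

namespace WFRun

theorem exists_action (hD : WFRun P qu m D) (hqu : P.Uncoverable qu) (j : ℕ) (e : Fin n) :
    ∃ k, j ≤ k ∧ ¬ P.isWaiting (D k e) :=
  ⟨j + m + 1, by omega, by
    rw [hD.tail _ (by omega)]; exact not_isWaiting_of_uncoverable hqu⟩

theorem exit_mem (hD : WFRun P qu m D) (hqu : P.Uncoverable qu) {κ : Q × ℕ}
    (hκ : κ ∈ active P D j) : κ.1 ∈ P.QA := by
  obtain ⟨e, -, rfl⟩ := hκ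
  exact (arrival_mem (hD.exists_action hqu j e)).2

theorem lt_key (hD : WFRun P qu m D) (hqu : P.Uncoverable qu) {e : Fin n}
    (hw : P.isWaiting (D j e)) : j < (key P D j e).2 :=
  lt_arrival (hD.exists_action hqu j e) hw

theorem le_of_isWaiting (hD : WFRun P qu m D) (hqu : P.Uncoverable qu) {e : Fin n}
    (hw : P.isWaiting (D j e)) : j ≤ m := by
  by_contra h
  rw [hD.tail j (by omega)] at hw
  exact not_isWaiting_of_uncoverable hqu hw

theorem snd_of_fst_eq (hD : WFRun P qu m D) (hqu : P.Uncoverable qu) {κ : Q × ℕ}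
    (hκ : κ ∈ active P D j) (h : κ.1 = qu) : κ.2 = m + 1 := by
  obtain ⟨e, hw, rfl⟩ := hκ
  have hj := hD.le_of_isWaiting hqu hw
  refine le_antisymm (arrival_le (by omega) ?_) ?_
  · rw [hD.tail _ (by omega)]; exact not_isWaiting_of_uncoverable hqu
  · by_contra hlt
    exact hD.ne_qu _ (Nat.le_of_lt_succ (not_le.1 hlt)) e h

theorem key_of_leave {e : Fin n} (hw : P.isWaiting (D j e))
    (hn : ¬ P.isWaiting (D (j + 1) e)) : key P D j e = (D (j + 1) e, j + 1) := by
  rw [← key_succ hw, key_of_action hn]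

theorem isWaiting_succ_iff (hD : WFRun P qu m D) (hqu : P.Uncoverable qu) {e : Fin n}
    (hw : P.isWaiting (D j e)) : P.isWaiting (D (j + 1) e) ↔ (key P D j e).2 ≠ j + 1 := by
  constructor
  · intro h
    have := hD.lt_key hqu h
    rw [key_succ hw] at this
    exact this.ne'
  · intro h
    by_contra hn
    rw [key_of_leave hw hn] at h
    exact h rfl

theorem key_eq (hD : WFRun P qu m D) (hqu : P.Uncoverable qu) {e₁ e₂ : Fin n}
    (hw : P.isWaiting (D j e₁)) (h : D j e₁ = D j e₂)
    (hx : (key P D j e₁).1 = (key P D j e₂).1) : key P D j e₁ = key P D j e₂ := by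
  obtain ⟨d, hd⟩ : ∃ d, m + 1 - j = d := ⟨_, rfl⟩
  induction d generalizing j with
  | zero => have := hD.le_of_isWaiting hqu hw; omega
  | succ d ih =>
    have h' := hD.together j e₁ e₂ h hw hx
    have hw₂ : P.isWaiting (D j e₂) := h ▸ hw
    by_cases hw' : P.isWaiting (D (j + 1) e₁)
    · rw [← key_succ hw, ← key_succ hw₂] at hx ⊢
      exact ih hw' h' hx (by omega)
    · rw [key_of_leave hw hw', key_of_leave hw₂ (h' ▸ hw'), h']

theorem exists_move (hD : WFRun P qu m D) (j : ℕ) (q : Q) :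
    ∃ σ : Q → Q, ∀ e, P.isWaiting (D j e) → (key P D j e).1 = q → σ (D j e) = D (j + 1) e := by
  classical
  refine ⟨fun p => if h : ∃ e, D j e = p ∧ P.isWaiting (D j e) ∧ (key P D j e).1 = q
    then D (j + 1) h.choose else p, fun e hw hx => ?_⟩
  have h : ∃ e', D j e' = D j e ∧ P.isWaiting (D j e') ∧ (key P D j e').1 = q := ⟨e, rfl, hw, hx⟩
  simp only [dif_pos h]
  obtain ⟨h1, h2, h3⟩ := h.choose_spec
  exact hD.together j _ _ h1 h2 (h3.trans hx.symm)

theorem coherent_loc (hD : WFRun P qu m D) (hqu : P.Uncoverable qu) (hι : GoodIds P qu D ι j) :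
    Coherent P (loc P D ι j) := by
  constructor
  · rintro _ ⟨κ, hκ, rfl⟩
    refine ⟨?_, hD.exit_mem hqu hκ, hι.pos κ hκ, hι.le κ hκ⟩
    rintro _ ⟨e, hw, -, rfl⟩
    exact hw
  · rintro _ ⟨κ, hκ, rfl⟩ _ ⟨κ', hκ', rfl⟩ hne hx
    have hne' : κ ≠ κ' := fun h => hne (h ▸ rfl)
    refine ⟨fun h => hne' (hι.inj κ hκ κ' hκ' hx h), ?_⟩
    ext p
    simp only [summ, Set.mem_inter_iff, Set.mem_empty_iff_false, iff_false, not_and]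
    rintro ⟨e, hw, rfl, rfl⟩ ⟨e', hw', rfl, h⟩
    exact hne' (hD.key_eq hqu hw h.symm hx)

theorem exists_fresh [Finite Q] (hD : WFRun P qu m D) (hqu : P.Uncoverable qu)
    (ι : Q × ℕ → ℕ) (j : ℕ) (q : Q) :
    ∃ k, 1 ≤ k ∧ k ≤ nW P + 1 ∧ (q, k) ∉ labs (loc P D ι j) := by
  classical
  set φ : Q → ℕ := fun p =>
    if h : ∃ e, D j e = p ∧ P.isWaiting (D j e) ∧ (key P D j e).1 = q
    then ι (key P D j h.choose) else 0
  have hsub : {k | (q, k) ∈ labs (loc P D ι j)} ⊆ φ '' P.QW := by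
    intro k hk
    obtain ⟨_, ⟨e, hw, rfl⟩, hx, hk⟩ := mem_labs_loc.1 hk
    refine ⟨D j e, hw, ?_⟩
    have h : ∃ e', D j e' = D j e ∧ P.isWaiting (D j e') ∧ (key P D j e').1 = q :=
      ⟨e, rfl, hw, hx⟩
    simp only [φ]
    rw [dif_pos h, ← hk]
    obtain ⟨h1, h2, h3⟩ := h.choose_spec
    rw [hD.key_eq hqu h2 h1 (h3.trans hx.symm)]
  have hfin : P.QW.Finite := Set.toFinite _
  have hlt : (φ '' P.QW).ncard < (Set.Icc 1 (nW P + 1)).ncard := by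
    refine (Set.ncard_image_le hfin).trans_lt ?_
    rw [← Finset.coe_Icc, Set.ncard_coe_finset, Nat.card_Icc]
    simp [nW]
  obtain ⟨k, hk, hk'⟩ := Set.exists_mem_notMem_of_ncard_lt_ncard hlt (hfin.image _)
  exact ⟨k, hk.1, hk.2, fun h => hk' (hsub h)⟩

theorem exists_ids [Finite Q] (hD : WFRun P qu m D) (hqu : P.Uncoverable qu)
    (ι : Q × ℕ → ℕ) (j : ℕ) :
    ∃ ι' : Q × ℕ → ℕ, (∀ κ ∈ active P D j, ι' κ = ι κ) ∧
      ∀ κ ∈ active P D (j + 1), κ ∉ active P D j → 1 ≤ ι' κ ∧ ι' κ ≤ nW P + 1 ∧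
        (κ.1, ι' κ) ∉ labs (loc P D ι j) ∧ (κ.1 = qu → ι' κ = 1) := by
  classical
  choose k h1 h2 h3 using hD.exists_fresh hqu ι j
  refine ⟨fun κ => if κ ∈ active P D j then ι κ else if κ.1 = qu then 1 else k κ.1,
    fun κ hκ => if_pos hκ, fun κ hκ hκ' => ?_⟩
  simp only [if_neg hκ']
  split_ifs with hx
  · refine ⟨le_rfl, by omega, fun h => ?_, fun _ => rfl⟩
    obtain ⟨κ', hκ'', h, -⟩ := mem_labs_loc.1 h
    refine hκ' ?_
    rwa [Prod.ext h ((hD.snd_of_fst_eq hqu hκ'' (h.trans hx)).trans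
      (hD.snd_of_fst_eq hqu hκ hx).symm)] at hκ''
  · exact ⟨h1 _, h2 _, h3 _, fun h => absurd h hx⟩

/-- Only the broadcaster `e₀` can make a key active. -/
theorem active_of_succ {e₀ : Fin n}
    (hother : ∀ e, e ≠ e₀ → P.isWaiting (D (j + 1) e) → P.isWaiting (D j e)) {κ : Q × ℕ}
    (hκ : κ ∈ active P D (j + 1)) (hκ' : κ ∉ active P D j) :
    P.isWaiting (D (j + 1) e₀) ∧ κ = key P D (j + 1) e₀ := by
  obtain ⟨e, hw, rfl⟩ := hκ
  by_cases he : e = e₀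
  · exact ⟨he ▸ hw, by rw [he]⟩
  · have hw' := hother e he hw
    exact absurd ⟨e, hw', (key_succ hw').symm⟩ hκ'

theorem exists_sim_step [Finite Q] (hWO : P.WaitOnly) (hD : WFRun P qu m D)
    (hqu : P.Uncoverable qu) (qf : Q) (hι : GoodIds P qu D ι j) (hj : j < m) :
    ∃ ι', GoodIds P qu D ι' (j + 1) ∧ (VP P qu qf).Reach
      (.co (loc P D ι j), cnt P (ctr P D ι j))
      (.co (loc P D ι' (j + 1)), cnt P (ctr P D ι' (j + 1))) := by
  classical
  obtain ⟨ι', hold, hnew⟩ := hD.exists_ids hqu ι j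
  obtain ⟨e₀, _, q, a, q', rfl, ht, rfl, rfl, hrecv⟩ := hD.step j hj
  have hq := not_isWaiting_of_send hWO ht
  have hstay : ∀ e, e ≠ e₀ → ¬ P.isWaiting (D j e) → D (j + 1) e = D j e := by
    intro e he hw
    rcases hrecv e he with h | ⟨-, h⟩
    · exact absurd ⟨a, _, h⟩ hw
    · exact h
  have hother : ∀ e, e ≠ e₀ → P.isWaiting (D (j + 1) e) → P.isWaiting (D j e) := by
    intro e he hw
    by_contra hn
    rw [hstay e he hn] at hw
    exact hn hw
  have hlive : ∀ κ ∈ active P D (j + 1), κ.2 ≠ j + 1 := by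
    rintro _ ⟨e, hw, rfl⟩
    exact (hD.lt_key hqu hw).ne'
  have hι' : GoodIds P qu D ι' (j + 1) := by
    refine ⟨fun κ hκ => ?_, fun κ hκ => ?_, ?_, fun κ hκ hx => ?_⟩
    · by_cases h : κ ∈ active P D j
      · rw [hold κ h]; exact hι.pos κ h
      · exact (hnew κ hκ h).1
    · by_cases h : κ ∈ active P D j
      · rw [hold κ h]; exact hι.le κ h
      · exact (hnew κ hκ h).2.1
    · intro κ hκ κ' hκ' hx hid
      by_cases h : κ ∈ active P D j <;> by_cases h' : κ' ∈ active P D j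
      · rw [hold κ h, hold κ' h'] at hid
        exact hι.inj κ h κ' h' hx hid
      · exact absurd (mem_labs_loc.2 ⟨κ, h, hx, by rw [← hid, hold κ h]⟩) (hnew κ' hκ' h').2.2.1
      · exact absurd (mem_labs_loc.2 ⟨κ', h', hx.symm, by rw [hid, hold κ' h']⟩)
          (hnew κ hκ h).2.2.1
      · rw [(active_of_succ hother hκ h).2, (active_of_succ hother hκ' h').2]
    · by_cases h : κ ∈ active P D j
      · rw [hold κ h]; exact hι.qu κ h hx
      · exact (hnew κ hκ h).2.2.2 hx
  choose σ hσ using hD.exists_move j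
  have hRecv : ∀ κ, RecvFun P a (print P D j κ) (σ κ.1) := by
    rintro κ _ ⟨e, hw, rfl, rfl⟩
    rw [hσ _ e hw rfl]
    exact hrecv e fun h => hq (h ▸ hw)
  have himgW : ∀ κ, κ.2 ≠ j + 1 → σ κ.1 '' print P D j κ ⊆ P.QW := by
    rintro κ hκ _ ⟨_, ⟨e, hw, rfl, rfl⟩, rfl⟩
    rw [hσ _ e hw rfl]
    exact (hD.isWaiting_succ_iff hqu hw).2 hκ
  have himg : ∀ κ, κ.2 ≠ j + 1 → ¬ (P.isWaiting (D (j + 1) e₀) ∧ κ = key P D (j + 1) e₀) →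
      print P D (j + 1) κ = σ κ.1 '' print P D j κ := by
    intro κ hκ hκ'
    ext p
    constructor
    · rintro ⟨e, hw, rfl, rfl⟩
      have he : e ≠ e₀ := fun h => hκ' ⟨h ▸ hw, by rw [h]⟩
      have hw' := hother e he hw
      exact ⟨D j e, ⟨e, hw', (key_succ hw').symm, rfl⟩, hσ _ e hw' (by rw [key_succ hw'])⟩
    · rintro ⟨_, ⟨e, hw, rfl, rfl⟩, rfl⟩
      exact ⟨e, (hD.isWaiting_succ_iff hqu hw).2 hκ, key_succ hw, (hσ _ e hw rfl).symm⟩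
  have himgJ : P.isWaiting (D (j + 1) e₀) → ∀ κ, κ = key P D (j + 1) e₀ →
      print P D (j + 1) κ = σ κ.1 '' print P D j κ ∪ {D (j + 1) e₀} := by
    rintro hw₀ κ hκ
    ext p
    constructor
    · rintro ⟨e, hw, rfl, rfl⟩
      by_cases he : e = e₀
      · right; rw [he]; rfl
      · have hw' := hother e he hw
        exact Or.inl
          ⟨D j e, ⟨e, hw', (key_succ hw').symm, rfl⟩, hσ _ e hw' (by rw [key_succ hw'])⟩
    · rintro (⟨_, ⟨e, hw, rfl, rfl⟩, rfl⟩ | rfl)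
      · refine ⟨e, (hD.isWaiting_succ_iff hqu hw).2 ?_, key_succ hw, (hσ _ e hw rfl).symm⟩
        rw [hκ]
        exact (hD.lt_key hqu hw₀).ne'
      · exact ⟨e₀, hw₀, hκ.symm, rfl⟩
  have : Nonempty (Q × ℕ) := ⟨(P.qin, 0)⟩
  set g : Summary Q → Option (Summary Q) := fun S =>
    let κ := Function.invFunOn (summ P D ι j) (active P D j) S
    if κ.2 = j + 1 then none else some (summ P D ι' (j + 1) κ) with hg
  have hgs : ∀ κ ∈ active P D j, g (summ P D ι j κ) =
      if κ.2 = j + 1 then none else some (summ P D ι' (j + 1) κ) := by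
    intro κ hκ
    simp only [hg]
    rw [(summ_injOn hι).leftInvOn_invFunOn hκ]
  have hsteps : ∀ κ ∈ active P D j,
      ¬ (P.isWaiting (D (j + 1) e₀) ∧ κ = key P D (j + 1) e₀) →
      stepsTo P (D j e₀, Act.send a, D (j + 1) e₀) (summ P D ι j κ) (g (summ P D ι j κ)) := by
    intro κ hκ hκ'
    rw [hgs κ hκ]
    split_ifs with hx
    · refine ⟨_, _, _, rfl, ht, σ κ.1, hRecv κ, ?_⟩
      have hex : ∀ e, P.isWaiting (D j e) → key P D j e = κ → σ κ.1 (D j e) = κ.1 := by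
        rintro e hw rfl
        rw [hσ _ e hw rfl]
        have hn := (hD.isWaiting_succ_iff hqu hw).not.2 (not_not.2 hx)
        rw [key_of_leave hw hn]
      obtain ⟨e, hw, hk⟩ := hκ
      ext p
      constructor
      · rintro ⟨_, ⟨e', hw', hk', rfl⟩, rfl⟩
        exact hex e' hw' hk'
      · rintro rfl
        exact ⟨D j e, ⟨e, hw, hk, rfl⟩, hex e hw hk⟩
    · exact ⟨_, _, _, rfl, ht, σ κ.1, hRecv κ, rfl, hold κ hκ, himg κ hx hκ', himgW κ hx⟩
  have hactive : ∀ κ ∈ active P D j, κ.2 ≠ j + 1 → κ ∈ active P D (j + 1) := by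
    rintro _ ⟨e, hw, rfl⟩ hx
    exact ⟨e, (hD.isWaiting_succ_iff hqu hw).2 hx, key_succ hw⟩
  have hgmem : ∀ κ ∈ active P D j, ∀ S', g (summ P D ι j κ) = some S' ↔
      κ ∈ active P D (j + 1) ∧ summ P D ι' (j + 1) κ = S' := by
    intro κ hκ S'
    rw [hgs κ hκ]
    split_ifs with hx
    · simpa using fun h => absurd hx (hlive κ h)
    · simp [hactive κ hκ hx]
  have hctr₀ : ctr P D ι j e₀ = .st (D j e₀) := if_neg hq
  have hcoh := hD.coherent_loc hqu hι
  have hcoh' := hD.coherent_loc hqu hι'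
  have hdelta : ∀ δ, (δ = fun y => chi P (ctr P D ι' (j + 1) e₀) y - chi P (.st (D j e₀)) y) →
      DeltaT P (D j e₀, Act.send a, D (j + 1) e₀) (loc P D ι j) δ (loc P D ι' (j + 1)) := by
    rintro δ hδ
    refine ⟨hcoh, hcoh', _, _, _, rfl, ht, ?_⟩
    by_cases hw₀ : P.isWaiting (D (j + 1) e₀)
    · right
      rw [ctr, if_pos hw₀] at hδ
      set κ₀ := key P D (j + 1) e₀ with hκ₀
      have hκ₀' : κ₀ ∈ active P D (j + 1) := ⟨e₀, hw₀, rfl⟩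
      by_cases hact : κ₀ ∈ active P D j
      · refine Or.inl ⟨hw₀, summ P D ι j κ₀, ⟨κ₀, hact, rfl⟩, summ P D ι' (j + 1) κ₀,
          ⟨_, _, _, rfl, ht, hw₀, σ κ₀.1, hRecv κ₀, rfl, hold κ₀ hact, himgJ hw₀ κ₀ rfl, ?_⟩,
          ⟨g, ?_, ?_⟩, ?_⟩
        · exact Set.union_subset (himgW κ₀ (hlive κ₀ hκ₀')) (Set.singleton_subset_iff.2 hw₀)
        · rintro _ ⟨κ, hκ, rfl⟩ hne
          exact hsteps κ hκ fun h => hne (by rw [h.2])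
        · ext S'
          simp only [Set.mem_insert_iff, Set.mem_ofPred_eq]
          constructor
          · rintro ⟨κ, hκ, rfl⟩
            by_cases hk : κ = κ₀
            · exact Or.inl (by rw [hk])
            · right
              have hκj : κ ∈ active P D j := by
                by_contra h
                exact hk (active_of_succ hother hκ h).2
              exact ⟨_, ⟨κ, hκj, rfl⟩, fun h => hk (summ_injOn hι hκj hact h),
                (hgmem κ hκj _).2 ⟨hκ, rfl⟩⟩
          · rintro (rfl | ⟨_, ⟨κ, hκ, rfl⟩, -, h⟩)
            · exact ⟨κ₀, hκ₀', rfl⟩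
            · obtain ⟨h1, h2⟩ := (hgmem κ hκ _).1 h
              exact ⟨κ, h1, h2⟩
        · rw [hδ, hold κ₀ hact]; rfl
      · obtain ⟨h1, h2, h3, -⟩ := hnew κ₀ hκ₀' hact
        refine Or.inr ⟨hw₀, κ₀.1, hD.exit_mem hqu hκ₀', ι' κ₀, h1, h2, h3, ⟨g, ?_, ?_⟩, hδ⟩
        · rintro _ ⟨κ, hκ, rfl⟩
          exact hsteps κ hκ fun h => hact (h.2 ▸ hκ)
        · have hs : summ P D ι' (j + 1) κ₀ = ⟨{D (j + 1) e₀}, κ₀.1, ι' κ₀⟩ := by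
            have hemp : print P D j κ₀ = ∅ :=
              Set.eq_empty_of_forall_notMem fun p ⟨e, hw, hk, _⟩ => hact ⟨e, hw, hk⟩
            rw [summ, himgJ hw₀ κ₀ rfl, hemp, Set.image_empty, Set.empty_union]
          rw [← hs]
          ext S'
          simp only [Set.mem_insert_iff, Set.mem_ofPred_eq]
          constructor
          · rintro ⟨κ, hκ, rfl⟩
            by_cases hκj : κ ∈ active P D j
            · exact Or.inr ⟨_, ⟨κ, hκj, rfl⟩, (hgmem κ hκj _).2 ⟨hκ, rfl⟩⟩
            · exact Or.inl (by rw [(active_of_succ hother hκ hκj).2])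
          · rintro (rfl | ⟨_, ⟨κ, hκ, rfl⟩, h⟩)
            · exact ⟨κ₀, hκ₀', rfl⟩
            · obtain ⟨h1, h2⟩ := (hgmem κ hκ _).1 h
              exact ⟨κ, h1, h2⟩
    · left
      rw [ctr, if_neg hw₀] at hδ
      refine ⟨hw₀, ⟨g, ?_, ?_⟩, hδ⟩
      · rintro _ ⟨κ, hκ, rfl⟩
        exact hsteps κ hκ fun h => hw₀ h.1
      · ext S'
        simp only [Set.mem_ofPred_eq]
        constructor
        · rintro ⟨κ, hκ, rfl⟩
          have hκj : κ ∈ active P D j := by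
            by_contra h
            exact hw₀ (active_of_succ hother hκ h).1
          exact ⟨_, ⟨κ, hκj, rfl⟩, (hgmem κ hκj _).2 ⟨hκ, rfl⟩⟩
        · rintro ⟨_, ⟨κ, hκ, rfl⟩, h⟩
          obtain ⟨h1, h2⟩ := (hgmem κ hκ _).1 h
          exact ⟨κ, h1, h2⟩
  refine ⟨ι', hι', Relation.ReflTransGen.head
    (b := (.co (loc P D ι' (j + 1)),
      cnt P (Function.update (ctr P D ι j) e₀ (ctr P D ι' (j + 1) e₀)))) ?_ ?_⟩
  · refine ⟨_, Or.inr <| Or.inr <| Or.inr <| Or.inr <| Or.inl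
      ⟨_, _, _, _, rfl, hdelta _ rfl⟩, fun x => ?_⟩
    rw [cnt_update, hctr₀]
  · refine reach_drain hcoh' _ _ fun e => ?_
    by_cases he : e = e₀
    · left; rw [he, Function.update_self]
    rw [Function.update_of_ne he]
    by_cases hw : P.isWaiting (D j e)
    · have hact : key P D j e ∈ active P D j := ⟨e, hw, rfl⟩
      by_cases hw' : P.isWaiting (D (j + 1) e)
      · left
        rw [ctr, ctr, if_pos hw, if_pos hw', key_succ hw, hold _ hact]
      · right
        refine ⟨_, hD.exit_mem hqu hact, _, hι.pos _ hact, hι.le _ hact, fun h => ?_,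
          by rw [ctr, if_pos hw], by rw [ctr, if_neg hw', key_of_leave hw hw']⟩
        obtain ⟨κ, hκ, hx, hid⟩ := mem_labs_loc.1 h
        by_cases hκj : κ ∈ active P D j
        · rw [hold κ hκj] at hid
          have := hlive κ hκ
          rw [hι.inj κ hκj _ hact hx hid, key_of_leave hw hw'] at this
          exact this rfl
        · exact (hnew κ hκ hκj).2.2.1 (mem_labs_loc.2 ⟨_, hact, hx.symm, hid.symm⟩)
    · left
      have hw' : ¬ P.isWaiting (D (j + 1) e) := fun h => hw (hother e he h)
      rw [ctr, ctr, if_neg hw, if_neg hw', hstay e he hw]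

theorem exists_sim [Finite Q] (hWO : P.WaitOnly) (hD : WFRun P qu m D) (hqu : P.Uncoverable qu)
    (qf : Q) (h0 : ∀ e, D 0 e = P.qin) (j : ℕ) (hj : j ≤ m) :
    ∃ ι, GoodIds P qu D ι j ∧ (VP P qu qf).Reach (.co ∅, cnt P fun _ : Fin n => .st P.qin)
      (.co (loc P D ι j), cnt P (ctr P D ι j)) := by
  induction j with
  | zero =>
    have hact : active P D 0 = ∅ := Set.eq_empty_of_forall_notMem fun κ ⟨e, hw, _⟩ =>
      hWO.2.1 (h0 e ▸ hw)
    refine ⟨fun _ => 1, ⟨by simp, by simp, by simp [hact], by simp⟩, ?_⟩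
    have hc : ctr P D (fun _ => 1) 0 = fun _ : Fin n => .st P.qin := by
      funext e
      rw [ctr, h0, if_neg hWO.2.1]
    rw [loc, hact, Set.image_empty, hc]
    exact .refl
  | succ j ih =>
    obtain ⟨ι, hι, hr⟩ := ih (by omega)
    obtain ⟨ι', hι', hr'⟩ := hD.exists_sim_step hWO hqu qf hι hj
    exact ⟨ι', hι', hr.trans hr'⟩

end WFRun

theorem reach_add {P : Protocol Q M} {qu qf : Q} (c : ℕ) :
    (VP P qu qf).Reach (.s0, 0) (.s0, cnt P fun _ : Fin c => .st P.qin) := by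
  induction c with
  | zero =>
    have : cnt P (fun _ : Fin 0 => .st P.qin) = 0 := by funext x; simp [cnt]
    rw [this]
    exact .refl
  | succ c ih =>
    refine ih.tail ⟨_, Or.inl rfl, fun x => ?_⟩
    simp only [cast_cnt, Finset.sum_const, Finset.card_univ, Fintype.card_fin]
    ring

theorem reach_sub {P : Protocol Q M} {qu qf : Q} (c : ℕ) :
    (VP P qu qf).Reach (.sf, cnt P fun _ : Fin c => .sm qu 1) (.sf, 0) := by
  induction c with
  | zero =>
    have : cnt P (fun _ : Fin 0 => .sm qu 1) = 0 := by funext x; simp [cnt]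
    rw [this]
    exact .refl
  | succ c ih =>
    refine .head ⟨_, Or.inr <| Or.inr <| Or.inr <| Or.inl rfl, fun x => ?_⟩ ih
    simp only [cast_cnt, Finset.sum_const, Finset.card_univ, Fintype.card_fin]
    ring

end Simulation

end BP

open BP in
/-- **Completeness of the VASS construction.** If some reachable configuration of `P`
puts every process on `q_f`, then `(s_0, 0) ⇝* (s_f, 0)` in `V_P`. -/
theorem vass_completeness {Q M : Type} [Fintype Q] [Fintype M]
    (P : Protocol Q M) (qu qf : Q)
    (hWO : P.WaitOnly) (hqu : P.Uncoverable qu) (hqf : qf ∈ P.QW)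
    {n : ℕ} (hn : 0 < n) (C C' : Fin n → Q)
    (hinit : P.Initial C) (hreach : P.Reach C C') (hqff : ∀ e, C' e = qf) :
    (VP P qu qf).Reach (LocW.s0, 0) (LocW.sf, 0) := by
  have : NeZero n := ⟨hn.ne'⟩
  obtain ⟨m, E, rfl, rfl, hstep, htail⟩ := exists_run qu hreach
  obtain ⟨D, h0, hm, hD⟩ := exists_wfRun hWO hqu hinit hqff hqf hstep htail
  obtain ⟨ι, hι, hr⟩ := hD.exists_sim hWO hqu qf h0 m le_rfl
  have hw : ∀ e, P.isWaiting (D m e) := fun e => by rw [hm]; exact hqf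
  have hkey : ∀ e, key P D m e = (qu, m + 1) := fun e => by
    have hD' : D (m + 1) e = qu := hD.tail _ (by omega) e
    rw [WFRun.key_of_leave (hw e) (hD' ▸ not_isWaiting_of_uncoverable hqu), hD']
  have hact : active P D m = {(qu, m + 1)} := by
    ext κ
    constructor
    · rintro ⟨e, -, rfl⟩
      exact hkey e
    · rintro rfl
      exact ⟨0, hw 0, hkey 0⟩
  have hid : ι (qu, m + 1) = 1 := hι.qu _ (by rw [hact]; rfl) rfl
  have hprint : print P D m (qu, m + 1) = {qf} := by
    ext p
    constructor
    · rintro ⟨e, -, -, rfl⟩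
      exact hm e
    · rintro rfl
      exact ⟨0, hw 0, hkey 0, hm 0⟩
  have hloc : loc P D ι m = {⟨{qf}, qu, 1⟩} := by
    rw [loc, hact, Set.image_singleton, summ, hprint, hid]
  have hctr : ctr P D ι m = fun _ => .sm qu 1 := by
    funext e
    rw [ctr, if_pos (hw e), hkey, hid]
  rw [hloc, hctr] at hr
  exact ((reach_add n).tail ⟨0, Or.inr (Or.inl rfl), fun x => by simp⟩).trans
    ((hr.tail ⟨0, Or.inr (Or.inr (Or.inl rfl)), fun x => by simp⟩).trans (reach_sub n))
end
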